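/- For every integer n ≥ 12: every 𝒫₄-free 3-graph H on n vertices that is not isomorphic to a sub-3-graph of the starplus Sₙ^{+1} satisfies |H| ≤ C(n−3,2) + 7, and equality holds if and only if H is isomorphic to the compact balloon CBₙ. -/

import Mathlib

open Finset

/-- `H` is a 3-graph on the vertex set `V`: every edge is a 3-element subset of `V`. -/
def ThreeGraphOn (V : Finset ℕ) (H : Finset (Finset ℕ)) : Prop :=
  ∀ e ∈ H, e ⊆ V ∧ e.card = 3

/-- Four edges form a 3-uniform minimal 4-path: `aᵢ ∩ aⱼ ≠ ∅ ↔ |i - j| ≤ 1`. -/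
def IsMinPath4 (a₀ a₁ a₂ a₃ : Finset ℕ) : Prop :=
  (a₀ ∩ a₁).Nonempty ∧ (a₁ ∩ a₂).Nonempty ∧ (a₂ ∩ a₃).Nonempty ∧
    a₀ ∩ a₂ = ∅ ∧ a₀ ∩ a₃ = ∅ ∧ a₁ ∩ a₃ = ∅

/-- `H` contains no minimal 4-path. -/
def P4Free (H : Finset (Finset ℕ)) : Prop :=
  ¬∃ a₀ ∈ H, ∃ a₁ ∈ H, ∃ a₂ ∈ H, ∃ a₃ ∈ H, IsMinPath4 a₀ a₁ a₂ a₃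

/-- `H` is a starplus on `V`: a full star with center `v` together with one
extra 3-edge not containing `v`. -/
def IsStarPlusOn (V : Finset ℕ) (H : Finset (Finset ℕ)) : Prop :=
  ∃ v ∈ V, ∃ e : Finset ℕ, e ⊆ V ∧ e.card = 3 ∧ v ∉ e ∧
    H = (V.powersetCard 3).filter (fun t => v ∈ t) ∪ {e}

/-- `H` is (isomorphic to) a sub-3-graph of the starplus on `V`. -/
def SubStarPlus (V : Finset ℕ) (H : Finset (Finset ℕ)) : Prop :=
  ∃ H' : Finset (Finset ℕ), IsStarPlusOn V H' ∧ H ⊆ H'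

/-- `H` is the compact balloon `CBₙ` on `V`: a full star on `V \ {z₁, z₂}`
with center `x`, together with the seven extra edges `{y₁,y₂,z₁}`,
`{y₁,y₂,z₂}`, `{x,yᵢ,zⱼ}` for `i,j ∈ {1,2}`, and `{x,z₁,z₂}`. -/
def IsCBOn (V : Finset ℕ) (H : Finset (Finset ℕ)) : Prop :=
  ∃ x y₁ y₂ z₁ z₂ : ℕ, ({x, y₁, y₂, z₁, z₂} : Finset ℕ) ⊆ V ∧
    ({x, y₁, y₂, z₁, z₂} : Finset ℕ).card = 5 ∧
    H = ((V \ {z₁, z₂}).powersetCard 3).filter (fun t => x ∈ t) ∪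
      ({{y₁, y₂, z₁}, {y₁, y₂, z₂}, {x, y₁, z₁}, {x, y₁, z₂},
        {x, y₂, z₁}, {x, y₂, z₂}, {x, z₁, z₂}} : Finset (Finset ℕ))

/-- `H` is (isomorphic to) a sub-3-graph of `CBₙ` on `V`. -/
def SubCB (V : Finset ℕ) (H : Finset (Finset ℕ)) : Prop :=
  ∃ H' : Finset (Finset ℕ), IsCBOn V H' ∧ H ⊆ H'

lemma card_superset_le {W P : Finset ℕ} {F : Finset (Finset ℕ)} {k : ℕ}
    (h : ∀ t ∈ F, t ⊆ W ∧ t.card = k ∧ P ⊆ t) :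
    F.card ≤ (W.card - P.card).choose (k - P.card) := by
  rcases F.eq_empty_or_nonempty with rfl | ⟨t, ht⟩
  · simp
  have hPW : P ⊆ W := (h t ht).2.2.trans (h t ht).1
  rw [← card_sdiff_of_subset hPW, ← card_powersetCard]
  apply card_le_card_of_injOn (fun t => t \ P)
  · intro t ht
    obtain ⟨h1, h2, h3⟩ := h t ht
    simp only [mem_coe, mem_powersetCard]
    refine ⟨sdiff_subset_sdiff h1 le_rfl, ?_⟩
    rw [card_sdiff_of_subset h3, h2]
  · intro a ha b hb hab
    have h1 := (h a ha).2.2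
    have h2 := (h b hb).2.2
    simp only at hab
    rw [← sdiff_union_of_subset h1, ← sdiff_union_of_subset h2, hab]

lemma star3 {W : Finset ℕ} {F : Finset (Finset ℕ)} (v : ℕ)
    (h : ∀ t ∈ F, t ⊆ W ∧ t.card = 3 ∧ v ∈ t) : F.card ≤ (W.card - 1).choose 2 := by
  have := card_superset_le (W := W) (P := {v}) (F := F) (k := 3)
    (by intro t ht; simpa using h t ht)
  simpa using this

lemma pair3 {W : Finset ℕ} {F : Finset (Finset ℕ)} (x y : ℕ) (hxy : x ≠ y)
    (h : ∀ t ∈ F, t ⊆ W ∧ t.card = 3 ∧ x ∈ t ∧ y ∈ t) : F.card ≤ W.card - 2 := by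
  have := card_superset_le (W := W) (P := {x, y}) (F := F) (k := 3)
    (by intro t ht; have := h t ht; refine ⟨this.1, this.2.1, ?_⟩; grind)
  simpa [card_pair hxy] using this

lemma star2 {W : Finset ℕ} {F : Finset (Finset ℕ)} (v : ℕ)
    (h : ∀ t ∈ F, t ⊆ W ∧ t.card = 2 ∧ v ∈ t) : F.card ≤ W.card - 1 := by
  have := card_superset_le (W := W) (P := {v}) (F := F) (k := 2)
    (by intro t ht; simpa using h t ht)
  simpa using this

lemma eq_pair {t : Finset ℕ} {x y : ℕ} (h : t.card = 2) (hx : x ∈ t) (hy : y ∈ t) (hxy : x ≠ y) :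
    t = {x, y} := by
  symm; apply eq_of_subset_of_card_le
  · grind
  · rw [card_pair hxy, h]

lemma eq_triple {t : Finset ℕ} {x y z : ℕ} (h : t.card = 3) (hx : x ∈ t) (hy : y ∈ t) (hz : z ∈ t)
    (hxy : x ≠ y) (hxz : x ≠ z) (hyz : y ≠ z) : t = {x, y, z} := by
  symm; apply eq_of_subset_of_card_le
  · grind
  · rw [card_eq_three.2 ⟨x, y, z, hxy, hxz, hyz, rfl⟩, h]

lemma three_of_pair {t : Finset ℕ} {x y : ℕ} (h : t.card = 3) (hx : x ∈ t) (hy : y ∈ t) (hxy : x ≠ y) :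
    ∃ z, z ≠ x ∧ z ≠ y ∧ t = {x, y, z} := by
  have : ∃ z ∈ t, z ∉ ({x, y} : Finset ℕ) := by
    by_contra! hc
    have := card_le_card (show t ⊆ {x, y} from hc)
    rw [card_pair hxy] at this; omega
  obtain ⟨z, hz, hz'⟩ := this
  refine ⟨z, by grind, by grind, eq_triple h hx hy hz hxy (by grind) (by grind)⟩

lemma three_of_mem {t : Finset ℕ} {x : ℕ} (h : t.card = 3) (hx : x ∈ t) :
    ∃ y z, x ≠ y ∧ x ≠ z ∧ y ≠ z ∧ t = {x, y, z} := by
  have : ∃ z ∈ t, z ∉ ({x} : Finset ℕ) := by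
    by_contra! hc
    have := card_le_card (show t ⊆ {x} from hc)
    simp at this; omega
  obtain ⟨y, hy, hy'⟩ := this
  have hxy : x ≠ y := by grind
  obtain ⟨z, h1, h2, h3⟩ := three_of_pair h hx hy hxy
  exact ⟨y, z, hxy, h1.symm, h2.symm, h3⟩

lemma card_or {α : Type*} (F : Finset α) (P Q : α → Prop) [DecidablePred P] [DecidablePred Q]
    (h : ∀ t ∈ F, P t ∨ Q t) : F.card ≤ (F.filter P).card + (F.filter Q).card := by
  classical
  refine le_trans (card_le_card ?_) (card_union_le _ _)
  intro t ht
  have := h t ht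
  simp [ht, this]

lemma pair3_or {F : Finset (Finset ℕ)} {g : Finset ℕ} {x : ℕ} {m : ℕ}
    (hm : ∀ y ∈ g, (F.filter (fun t => x ∈ t ∧ y ∈ t)).card ≤ m)
    (hg : ∀ t ∈ F, x ∈ t → ∃ y ∈ g, y ∈ t) :
    (F.filter (fun t => x ∈ t)).card ≤ g.card * m := by
  have : F.filter (fun t => x ∈ t) ⊆ g.biUnion (fun y => F.filter (fun t => x ∈ t ∧ y ∈ t)) := by
    intro t ht
    rw [mem_filter] at ht
    obtain ⟨y, hy, hyt⟩ := hg t ht.1 ht.2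
    simp only [mem_biUnion, mem_filter]
    exact ⟨y, hy, ht.1, ht.2, hyt⟩
  exact (card_le_card this).trans (card_biUnion_le_card_mul _ _ _ hm)

lemma nopath {H : Finset (Finset ℕ)} (hfree : P4Free H) {a b c d : Finset ℕ} (x y z : ℕ)
    (ha : a ∈ H) (hb : b ∈ H) (hc : c ∈ H) (hd : d ∈ H)
    (h1 : x ∈ a ∧ x ∈ b) (h2 : y ∈ b ∧ y ∈ c) (h3 : z ∈ c ∧ z ∈ d)
    (h4 : Disjoint a c) (h5 : Disjoint a d) (h6 : Disjoint b d) : False := by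
  apply hfree
  refine ⟨a, ha, b, hb, c, hc, d, hd, ⟨x, by simp [h1]⟩, ⟨y, by simp [h2]⟩, ⟨z, by simp [h3]⟩,
    disjoint_iff_inter_eq_empty.1 h4, disjoint_iff_inter_eq_empty.1 h5,
    disjoint_iff_inter_eq_empty.1 h6⟩

/-- Seinsche: cographs. -/
lemma cograph {α : Type*} [DecidableEq α] : ∀ (N : ℕ) (S : Finset α), S.card = N →
    ∀ (R : α → α → Prop), (∀ a b, R a b → R b a) →
    (∀ a ∈ S, ∀ b ∈ S, ∀ c ∈ S, ∀ d ∈ S, R a b → R b c → R c d → ¬ R a c → ¬ R a d → ¬ R b d → False) →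
    2 ≤ N → ∃ X Y, X ∪ Y = S ∧ Disjoint X Y ∧ X.Nonempty ∧ Y.Nonempty ∧
      ((∀ x ∈ X, ∀ y ∈ Y, R x y) ∨ (∀ x ∈ X, ∀ y ∈ Y, ¬ R x y)) := by
  intro N
  induction N with
  | zero => intros; omega
  | succ N ih =>
    intro S hS R hsymm hP h2
    obtain ⟨v, hv⟩ : S.Nonempty := card_pos.1 (by omega)
    -- key step
    have key : ∀ (R : α → α → Prop), (∀ a b, R a b → R b a) →
        (∀ a ∈ S, ∀ b ∈ S, ∀ c ∈ S, ∀ d ∈ S, R a b → R b c → R c d → ¬ R a c → ¬ R a d → ¬ R b d → False) →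
        (∃ X Y, X ∪ Y = S.erase v ∧ Disjoint X Y ∧ X.Nonempty ∧ Y.Nonempty ∧
          (∀ x ∈ X, ∀ y ∈ Y, ¬ R x y)) →
        ∃ X Y, X ∪ Y = S ∧ Disjoint X Y ∧ X.Nonempty ∧ Y.Nonempty ∧
      ((∀ x ∈ X, ∀ y ∈ Y, R x y) ∨ (∀ x ∈ X, ∀ y ∈ Y, ¬ R x y)) := by
      classical
      intro R hsymm hP ⟨X₀, Y₀, hXY, hdis, hX, hY, hR⟩
      by_cases hall : ∀ u ∈ S.erase v, R v u
      · refine ⟨{v}, S.erase v, ?_, ?_, by simp, ?_, Or.inl ?_⟩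
        · ext; grind
        · simp
        · rw [← hXY]; exact hX.mono subset_union_left
        · simpa using hall
      push Not at hall
      obtain ⟨u, hu, huv⟩ := hall
      -- wlog u in X
      have wl : ∀ X Y, X ∪ Y = S.erase v → Disjoint X Y → X.Nonempty → Y.Nonempty →
          (∀ x ∈ X, ∀ y ∈ Y, ¬ R x y) → u ∈ X →
          ∃ X Y, X ∪ Y = S ∧ Disjoint X Y ∧ X.Nonempty ∧ Y.Nonempty ∧
      ((∀ x ∈ X, ∀ y ∈ Y, R x y) ∨ (∀ x ∈ X, ∀ y ∈ Y, ¬ R x y)) := by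
        intro X Y hXY hdis hX hY hR huX
        have hmem : ∀ a, a ∈ S ↔ a = v ∨ a ∈ X ∨ a ∈ Y := by
          intro a
          have := congrArg (fun T => a ∈ T) hXY
          simp only [mem_union, mem_erase, eq_iff_iff] at this
          by_cases h : a = v <;> grind
        have hvX : v ∉ X ∧ v ∉ Y := by
          have := congrArg (fun T => v ∈ T) hXY
          simp only [mem_union, mem_erase, eq_iff_iff] at this
          grind
        have hd : ∀ a, a ∈ X → a ∉ Y := fun a h => disjoint_left.1 hdis h
        by_cases hc1 : ∃ p ∈ X, ∃ q ∈ X, R v p ∧ ¬ R v q ∧ R p q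
        · obtain ⟨p, hp, q, hq, h1, h2, h3⟩ := hc1
          by_cases hc2 : ∃ r ∈ Y, R v r
          · obtain ⟨r, hr, hvr⟩ := hc2
            exfalso
            refine hP q ((hmem q).2 (by simp [hq])) p ((hmem p).2 (by simp [hp])) v hv r
              ((hmem r).2 (by simp [hr])) (hsymm _ _ h3) (hsymm _ _ h1) hvr
              (fun h => h2 (hsymm _ _ h)) (hR q hq r hr) (hR p hp r hr)
          · push Not at hc2
            refine ⟨insert v X, Y, ?_, ?_, by simp, hY, Or.inr ?_⟩
            · ext a; rw [hmem]; simp [or_assoc]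
            · simp [hvX.2, hdis]
            · intro x hx y hy
              rcases mem_insert.1 hx with rfl | hx
              · exact hc2 y hy
              · exact hR x hx y hy
        · push Not at hc1
          refine ⟨X.filter (fun q => ¬ R v q), insert v (Y ∪ X.filter (fun q => R v q)), ?_, ?_,
            ⟨u, by simp [huX, huv]⟩, by simp, Or.inr ?_⟩
          · ext a; rw [hmem]; simp only [mem_union, mem_insert, mem_filter]; tauto
          · rw [disjoint_left]; intro a ha hb
            simp only [mem_union, mem_insert, mem_filter] at ha hb
            have := hd a ha.1
            rcases hb with rfl | hb | hb
            · exact hvX.1 ha.1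
            · exact this hb
            · exact ha.2 hb.2
          · intro x hx y hy
            simp only [mem_union, mem_insert, mem_filter] at hx hy
            rcases hy with rfl | hy | hy
            · exact fun h => hx.2 (hsymm _ _ h)
            · exact hR x hx.1 y hy
            · exact fun h => hc1 y hy.1 x hx.1 hy.2 hx.2 (hsymm _ _ h)
      have : u ∈ X₀ ∪ Y₀ := hXY ▸ hu
      rcases mem_union.1 this with h | h
      · exact wl X₀ Y₀ hXY hdis hX hY hR h
      · exact wl Y₀ X₀ (by rw [union_comm]; exact hXY) hdis.symm hY hX
          (fun x hx y hy h' => hR y hy x hx (hsymm _ _ h')) h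
    by_cases hN : N = 1
    · obtain ⟨u, hu⟩ : (S.erase v).Nonempty := card_pos.1 (by rw [card_erase_of_mem hv]; omega)
      have he : S.erase v = {u} := by
        obtain ⟨w, hw⟩ := card_eq_one.1 (show (S.erase v).card = 1 by rw [card_erase_of_mem hv]; omega)
        rw [hw] at hu ⊢; simp at hu; simp [hu]
      refine ⟨{v}, {u}, ?_, ?_, by simp, by simp, ?_⟩
      · rw [← he]; ext; grind
      · simp; grind
      · simp; exact em _
    · obtain ⟨X, Y, h1, h2', h3, h4, h5⟩ := ih (S.erase v) (by rw [card_erase_of_mem hv]; omega) R hsymm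
        (fun a ha b hb c hc d hd => hP a (mem_of_mem_erase ha) b (mem_of_mem_erase hb) c
          (mem_of_mem_erase hc) d (mem_of_mem_erase hd)) (by omega)
      rcases h5 with h5 | h5
      · obtain ⟨X', Y', g1, g2, g3, g4, g5⟩ := key (fun a b => ¬ R a b) (fun a b h h' => h (hsymm _ _ h'))
          (fun a ha b hb c hc d hd k1 k2 k3 k4 k5 k6 => by
            simp only [not_not] at k4 k5 k6
            exact hP c hc a ha d hd b hb (hsymm _ _ k4) k5 (hsymm _ _ k6) k3 (fun h => k2 (hsymm _ _ h)) k1)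
          ⟨X, Y, h1, h2', h3, h4, by simpa using h5⟩
        refine ⟨X', Y', g1, g2, g3, g4, ?_⟩
        simp only [not_not] at g5
        exact g5.symm
      · exact key R hsymm hP ⟨X, Y, h1, h2', h3, h4, h5⟩

/-- decomposition of a non-intersecting P4-free family -/
lemma decomp {H : Finset (Finset ℕ)} (hfree : P4Free H)
    (hni : ∃ e ∈ H, ∃ f ∈ H, Disjoint e f) (hne : ∀ e ∈ H, e.Nonempty) :
    ∃ B₁ B₂ C : Finset (Finset ℕ), H = B₁ ∪ B₂ ∪ C ∧ B₁.Nonempty ∧ B₂.Nonempty ∧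
      (∀ a ∈ B₁, ∀ b ∈ B₂, Disjoint a b) ∧
      (∀ c ∈ C, ∀ b ∈ B₁ ∪ B₂, ∃ x, x ∈ c ∧ x ∈ b) := by
  classical
  let Q : Finset (Finset ℕ) → Prop := fun A => (∃ e ∈ A, ∃ f ∈ A, Disjoint e f) ∧
    ∀ c ∈ H \ A, ∀ b ∈ A, ∃ x, x ∈ c ∧ x ∈ b
  have hQ : (H.powerset.filter Q).Nonempty := ⟨H, by simp only [Q, mem_filter, mem_powerset, subset_refl, hni, true_and, sdiff_self]; intro c hc; simp at hc⟩
  obtain ⟨A, hA, hmin⟩ := exists_min_image _ (fun A => A.card) hQ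
  simp only [mem_filter, mem_powerset] at hA hmin
  obtain ⟨hAH, ⟨e, he, f, hf, hef⟩, hAc⟩ := hA
  have h2 : 2 ≤ A.card := by
    have : e ≠ f := by
      rintro rfl
      have := hne e (hAH he)
      simp at hef; simp [hef] at this
    exact one_lt_card.2 ⟨e, he, f, hf, this⟩
  obtain ⟨X, Y, h1, hd, hX, hY, h⟩ := cograph A.card A rfl (fun a b => ∃ x, x ∈ a ∧ x ∈ b)
    (fun a b ⟨x, h1, h2⟩ => ⟨x, h2, h1⟩)
    (by
      rintro a ha b hb c hc d hd ⟨x, hx⟩ ⟨y, hy⟩ ⟨z, hz⟩ h1 h2 h3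
      exact nopath hfree x y z (hAH ha) (hAH hb) (hAH hc) (hAH hd) hx hy hz
        (disjoint_left.2 fun a h h' => h1 ⟨a, h, h'⟩) (disjoint_left.2 fun a h h' => h2 ⟨a, h, h'⟩)
        (disjoint_left.2 fun a h h' => h3 ⟨a, h, h'⟩)) h2
  rcases h with h | h
  · exfalso
    have aux : ∀ X Y, X ∪ Y = A → Disjoint X Y → Y.Nonempty → (∀ x ∈ X, ∀ y ∈ Y, ∃ z, z ∈ x ∧ z ∈ y) →
        (∃ e ∈ X, ∃ f ∈ X, Disjoint e f) → False := by
      intro X Y h1 hd hY h hex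
      have hlt : X.card < A.card := by
        rw [← h1, card_union_of_disjoint hd]; have := card_pos.2 hY; omega
      have := hmin X ⟨(h1 ▸ subset_union_left).trans hAH, hex, ?_⟩
      · omega
      · intro c hc b hb
        rw [mem_sdiff] at hc
        by_cases hcA : c ∈ A
        · have : c ∈ Y := by rw [← h1, mem_union] at hcA; exact hcA.resolve_left hc.2
          obtain ⟨z, h1, h2⟩ := h b hb c this
          exact ⟨z, h2, h1⟩
        · exact hAc c (mem_sdiff.2 ⟨hc.1, hcA⟩) b (h1 ▸ mem_union_left _ hb)
    rw [← h1, mem_union] at he hf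
    rcases he with he | he <;> rcases hf with hf | hf
    · exact aux X Y h1 hd hY h ⟨e, he, f, hf, hef⟩
    · obtain ⟨z, h1, h2⟩ := h e he f hf
      exact disjoint_left.1 hef h1 h2
    · obtain ⟨z, h1, h2⟩ := h f hf e he
      exact disjoint_left.1 hef h2 h1
    · exact aux Y X (by rw [union_comm]; exact h1) hd.symm hX
        (fun y hy x hx => by obtain ⟨z, h1, h2⟩ := h x hx y hy; exact ⟨z, h2, h1⟩) ⟨e, he, f, hf, hef⟩
  · refine ⟨X, Y, H \ A, ?_, hX, hY, ?_, ?_⟩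
    · rw [h1, union_sdiff_of_subset hAH]
    · intro a ha b hb
      rw [disjoint_left]; intro x hx hx'; exact h a ha b hb ⟨x, hx, hx'⟩
    · rw [h1]; exact hAc

lemma two_cases {k k' : Finset ℕ} (h : k.card = 2) (h' : k'.card = 2) (hne : k ≠ k') :
    (Disjoint k k') ∨ ∃ c d d', c ≠ d ∧ c ≠ d' ∧ d ≠ d' ∧ k = {c, d} ∧ k' = {c, d'} := by
  by_cases hd : Disjoint k k'
  · exact Or.inl hd
  · right
    rw [not_disjoint_iff] at hd
    obtain ⟨c, hc, hc'⟩ := hd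
    obtain ⟨x, y, hxy, rfl⟩ := card_eq_two.1 h
    obtain ⟨z, w, hzw, rfl⟩ := card_eq_two.1 h'
    simp only [mem_insert, mem_singleton] at hc hc'
    rcases hc with rfl | rfl <;> rcases hc' with rfl | rfl
    · exact ⟨c, y, w, hxy, hzw, by grind, rfl, rfl⟩
    · exact ⟨c, y, z, hxy, hzw.symm, by grind, rfl, pair_comm _ _⟩
    · exact ⟨c, x, w, hxy.symm, hzw, by grind, pair_comm _ _, rfl⟩
    · exact ⟨c, x, z, hxy.symm, hzw.symm, by grind, pair_comm _ _, pair_comm _ _⟩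

/-- cross-intersecting families of pairs -/
def Cross (K L : Finset (Finset ℕ)) : Prop := ∀ k ∈ K, ∀ l ∈ L, ∃ x, x ∈ k ∧ x ∈ l

lemma Cross.symm {K L : Finset (Finset ℕ)} (h : Cross K L) : Cross L K :=
  fun l hl k hk => by obtain ⟨x, h1, h2⟩ := h k hk l hl; exact ⟨x, h2, h1⟩

lemma gA {W : Finset ℕ} {K L : Finset (Finset ℕ)} (hK : ∀ k ∈ K, k ⊆ W ∧ k.card = 2)
    (hL : ∀ l ∈ L, l ⊆ W ∧ l.card = 2) (hx : Cross K L) (hne : K.Nonempty) :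
    L.card ≤ 2 * W.card - 3 := by
  obtain ⟨k, hk⟩ := hne
  obtain ⟨hkW, hk2⟩ := hK k hk
  obtain ⟨y, z, hyz, rfl⟩ := card_eq_two.1 hk2
  have h1 := card_or L (fun l => y ∈ l) (fun l => z ∈ l ∧ y ∉ l) (by
    intro l hl
    obtain ⟨x, hx1, hx2⟩ := hx _ hk l hl
    grind)
  have h2 := star2 (W := W) (F := L.filter (fun l => y ∈ l)) y (by
    intro t ht; rw [mem_filter] at ht; exact ⟨(hL t ht.1).1, (hL t ht.1).2, ht.2⟩)
  have h3 := star2 (W := W.erase y) (F := L.filter (fun l => z ∈ l ∧ y ∉ l)) z (by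
    intro t ht; rw [mem_filter] at ht
    exact ⟨subset_erase.2 ⟨(hL t ht.1).1, ht.2.2⟩, (hL t ht.1).2, ht.2.1⟩)
  have hy : y ∈ W := hkW (by simp)
  have := card_le_card hkW
  rw [card_pair hyz] at this
  rw [card_erase_of_mem hy] at h3
  omega

lemma gDisj {K L : Finset (Finset ℕ)} 
    (hL : ∀ l ∈ L, l.card = 2) (hx : Cross K L) {k k' : Finset ℕ} (hk : k ∈ K) (hk' : k' ∈ K)
    (h2 : k.card = 2) (h2' : k'.card = 2) (hd : Disjoint k k') : L.card ≤ 4 := by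
  obtain ⟨a, b, hab, rfl⟩ := card_eq_two.1 h2
  obtain ⟨c, d, hcd, rfl⟩ := card_eq_two.1 h2'
  have : L ⊆ {{a, c}, {a, d}, {b, c}, {b, d}} := by
    intro l hl
    obtain ⟨x, h1, h2⟩ := hx _ hk l hl
    obtain ⟨y, h3, h4⟩ := hx _ hk' l hl
    have hxy : x ≠ y := fun h => disjoint_left.1 hd h1 (h ▸ h3)
    have := eq_pair (hL l hl) h2 h4 hxy
    simp only [mem_insert, mem_singleton] at h1 h3
    rcases h1 with rfl | rfl <;> rcases h3 with rfl | rfl <;> simp [this]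
  exact (card_le_card this).trans card_le_four

lemma gB {W : Finset ℕ} {K L : Finset (Finset ℕ)} (hK : ∀ k ∈ K, k ⊆ W ∧ k.card = 2)
    (hL : ∀ l ∈ L, l ⊆ W ∧ l.card = 2) (hx : Cross K L) (hne : 2 ≤ K.card) :
    L.card ≤ max W.card 4 := by
  obtain ⟨k, hk, k', hk', hkk⟩ := one_lt_card.1 (show 1 < K.card by omega)
  rcases two_cases (hK k hk).2 (hK k' hk').2 hkk with hd | ⟨c, d, d', h1, h2, h3, rfl, rfl⟩
  · exact (gDisj (fun l hl => (hL l hl).2) hx hk hk' (hK k hk).2 (hK k' hk').2 hd).trans (le_max_right _ _)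
  · have e1 := card_or L (fun l => c ∈ l) (fun l => l = {d, d'}) (by
      intro l hl
      obtain ⟨x, hx1, hx2⟩ := hx _ hk l hl
      obtain ⟨y, hy1, hy2⟩ := hx _ hk' l hl
      by_cases hc : c ∈ l
      · exact Or.inl hc
      · right
        have : x = d := by grind
        have : y = d' := by grind
        subst x y
        exact eq_pair (hL l hl).2 hx2 hy2 h3)
    have e2 := star2 (W := W) (F := L.filter (fun l => c ∈ l)) c (by
      intro t ht; rw [mem_filter] at ht; exact ⟨(hL t ht.1).1, (hL t ht.1).2, ht.2⟩)
    have e3 : (L.filter (fun l => l = {d, d'})).card ≤ 1 := by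
      refine (card_le_card (t := {{d, d'}}) ?_).trans (by simp)
      intro t ht; simp at ht; simp [ht.2]
    have := card_le_card (hK _ hk).1
    rw [card_pair h1] at this
    have := le_max_left W.card 4
    omega

lemma gC {K L : Finset (Finset ℕ)} (hK : ∀ k ∈ K, k.card = 2)
    (hL : ∀ l ∈ L, l.card = 2) (hx : Cross K L) (hne : 3 ≤ K.card)
    (hno : ∀ a, ∃ l ∈ L, a ∉ l) : L.card ≤ 4 := by
  by_cases hd : ∃ k ∈ K, ∃ k' ∈ K, Disjoint k k'
  · obtain ⟨k, hk, k', hk', hd⟩ := hd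
    exact gDisj hL hx hk hk' (hK k hk) (hK k' hk') hd
  push Not at hd
  obtain ⟨k, k', k'', hk, hk', hk'', h1, h2, h3⟩ := two_lt_card_iff.1 (show 2 < K.card by omega)
  rcases two_cases (hK k hk) (hK k' hk') h1 with hdd | ⟨c, d, d', e1, e2, e3, rfl, rfl⟩
  · exact absurd hdd (hd _ hk _ hk')
  by_cases hc : c ∈ k''
  · exfalso
    obtain ⟨l, hl, hcl⟩ := hno c
    obtain ⟨x, hx1, hx2⟩ := hx _ hk l hl
    obtain ⟨y, hy1, hy2⟩ := hx _ hk' l hl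
    obtain ⟨z, hz1, hz2⟩ := hx _ hk'' l hl
    have hzc : z ≠ c := by grind
    have e4 := eq_pair (hK _ hk'') hc hz1 hzc.symm
    have : l = {d, d'} := eq_pair (hL l hl) (by grind) (by grind) e3
    grind
  · have e4 : k'' = {d, d'} := by
      have a1 := hd _ hk _ hk''
      have a2 := hd _ hk' _ hk''
      rw [not_disjoint_iff] at a1 a2
      obtain ⟨x, hx1, hx2⟩ := a1
      obtain ⟨y, hy1, hy2⟩ := a2
      exact eq_pair (hK _ hk'') (by grind) (by grind) e3
    subst e4
    have : L ⊆ {{c, d}, {c, d'}, {d, d'}} := by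
      intro l hl
      obtain ⟨x, hx1, hx2⟩ := hx _ hk l hl
      obtain ⟨y, hy1, hy2⟩ := hx _ hk' l hl
      obtain ⟨z, hz1, hz2⟩ := hx _ hk'' l hl
      simp only [mem_insert, mem_singleton] at hx1 hy1 hz1 ⊢
      by_cases m1 : c ∈ l
      · by_cases m2 : d ∈ l
        · left; exact eq_pair (hL l hl) m1 m2 e1
        · right; left; exact eq_pair (hL l hl) m1 (by grind) e2
      · right; right; exact eq_pair (hL l hl) (by grind) (by grind) e3
    exact (card_le_card this).trans (card_le_three.trans (by norm_num))

/-- degree of the cover family -/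
lemma gDeg {K L : Finset (Finset ℕ)} (hK : ∀ k ∈ K, k.card = 2) (hx : Cross K L)
    (a : ℕ) {l : Finset ℕ} (hl : l ∈ L) (ha : a ∉ l) : (K.filter (fun k => a ∈ k)).card ≤ l.card := by
  have : K.filter (fun k => a ∈ k) ⊆ l.image (fun x => {a, x}) := by
    intro k hk
    rw [mem_filter] at hk
    obtain ⟨x, h1, h2⟩ := hx k hk.1 l hl
    rw [mem_image]
    exact ⟨x, h2, (eq_pair (hK k hk.1) hk.2 h1 (by grind)).symm⟩
  exact (card_le_card this).trans card_image_le

/-- total number of covers -/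
lemma gTot {K L : Finset (Finset ℕ)} {r : ℕ} (hK : ∀ k ∈ K, k.card = 2) (hx : Cross K L)
    (hL : ∀ l ∈ L, l.card = r) (hno : ∀ a, ∃ l ∈ L, a ∉ l) : K.card ≤ r * r := by
  obtain ⟨l, hl, -⟩ := hno 0
  have : K ⊆ l.biUnion (fun a => K.filter (fun k => a ∈ k)) := by
    intro k hk
    obtain ⟨x, h1, h2⟩ := hx k hk l hl
    simp only [mem_biUnion, mem_filter]
    exact ⟨x, h2, hk, h1⟩
  have h2 := (card_le_card this).trans (card_biUnion_le_card_mul _ _ r (by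
    intro a _
    obtain ⟨l', hl', ha⟩ := hno a
    rw [← hL l' hl']
    exact gDeg hK hx a hl' ha))
  rwa [hL l hl] at h2

lemma gD {K L : Finset (Finset ℕ)} (hK : ∀ k ∈ K, k.card = 2)
    (hL : ∀ l ∈ L, l.card = 2) (hx : Cross K L) (hne : 4 ≤ K.card)
    (hno : ∀ a, ∃ l ∈ L, a ∉ l) : L.card ≤ 2 := by
  by_contra! h3
  obtain ⟨l1, l2, l3, m1, m2, m3, n1, n2, n3⟩ := two_lt_card_iff.1 h3
  have dis : ∀ l ∈ L, ∀ l' ∈ L, l ≠ l' → Disjoint l l' := by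
    intro l hl l' hl' hll
    rcases two_cases (hL l hl) (hL l' hl') hll with hdd | ⟨c, d, d', e1, e2, e3, rfl, rfl⟩
    · exact hdd
    exfalso
    have e1 := card_or K (fun l => c ∈ l) (fun l => l = {d, d'}) (by
      intro k hk
      obtain ⟨x, hx1, hx2⟩ := hx k hk _ hl
      obtain ⟨y, hy1, hy2⟩ := hx k hk _ hl'
      by_cases hc : c ∈ k
      · exact Or.inl hc
      · right
        exact eq_pair (hK k hk) (by grind) (by grind) e3)
    have e3 : (K.filter (fun l => l = {d, d'})).card ≤ 1 := by
      refine (card_le_card (t := {{d, d'}}) ?_).trans (by simp)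
      intro t ht; simp at ht; simp [ht.2]
    obtain ⟨l, hl, hcl⟩ := hno c
    have := gDeg hK hx c hl hcl
    rw [hL l hl] at this
    omega
  obtain ⟨k, hk⟩ : K.Nonempty := card_pos.1 (by omega)
  obtain ⟨x, hx1, hx2⟩ := hx k hk _ m1
  obtain ⟨y, hy1, hy2⟩ := hx k hk _ m2
  obtain ⟨z, hz1, hz2⟩ := hx k hk _ m3
  have d1 : x ≠ y := fun h => disjoint_left.1 (dis _ m1 _ m2 n1) hx2 (h ▸ hy2)
  have d2 : x ≠ z := fun h => disjoint_left.1 (dis _ m1 _ m3 n2) hx2 (h ▸ hz2)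
  have d3 : y ≠ z := fun h => disjoint_left.1 (dis _ m2 _ m3 n3) hy2 (h ▸ hz2)
  have := card_le_card (show ({x, y, z} : Finset ℕ) ⊆ k by grind)
  rw [card_eq_three.2 ⟨x, y, z, d1, d2, d3, rfl⟩, hK k hk] at this
  omega

lemma gC' {W : Finset ℕ} {K L : Finset (Finset ℕ)} (hK : ∀ k ∈ K, k.card = 2)
    (hL : ∀ l ∈ L, l ⊆ W ∧ l.card = 2) (hx : Cross K L) (hne : 3 ≤ K.card) :
    L.card ≤ max (W.card - 1) 4 := by
  by_cases hno : ∀ a, ∃ l ∈ L, a ∉ l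
  · exact (gC hK (fun l hl => (hL l hl).2) hx hne hno).trans (le_max_right _ _)
  · push Not at hno
    obtain ⟨a, ha⟩ := hno
    exact (star2 (W := W) a (fun t ht => ⟨(hL t ht).1, (hL t ht).2, ha t ht⟩)).trans (le_max_left _ _)

lemma cross2 {W : Finset ℕ} {K L : Finset (Finset ℕ)} (hK : ∀ k ∈ K, k ⊆ W ∧ k.card = 2)
    (hL : ∀ l ∈ L, l ⊆ W ∧ l.card = 2) (hx : Cross K L) (h1 : K.Nonempty) (h2 : L.Nonempty) :
    K.card + L.card ≤ max (2 * W.card - 2) 8 := by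
  have a1 := gA hK hL hx h1
  have a2 := gA hL hK hx.symm h2
  have b1 := gB hK hL hx
  have b2 := gB hL hK hx.symm
  have c1 := gC' (fun k hk => (hK k hk).2) hL hx
  have c2 := gC' (fun k hk => (hL k hk).2) hK hx.symm
  have p1 := card_pos.2 h1
  have p2 := card_pos.2 h2
  omega

section tau2
variable {U : Finset ℕ} {B G : Finset (Finset ℕ)}

lemma pairCount (hB : ∀ b ∈ B, b ⊆ U ∧ b.card = 3) (x y : ℕ) (hxy : x ≠ y) :
    (B.filter (fun t => x ∈ t ∧ y ∈ t)).card ≤ U.card - 2 :=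
  pair3 x y hxy (by
    intro t ht; rw [mem_filter] at ht
    exact ⟨(hB t ht.1).1, (hB t ht.1).2, ht.2.1, ht.2.2⟩)

lemma starCount (hB : ∀ b ∈ B, b ⊆ U ∧ b.card = 3) (x : ℕ) :
    (B.filter (fun t => x ∈ t)).card ≤ (U.card - 1).choose 2 :=
  star3 x (by
    intro t ht; rw [mem_filter] at ht
    exact ⟨(hB t ht.1).1, (hB t ht.1).2, ht.2⟩)

lemma h3disj (hB : ∀ b ∈ B, b ⊆ U ∧ b.card = 3) (hx : Cross G B) {g g' : Finset ℕ}
    (hg : g ∈ G) (hg' : g' ∈ G) (h2 : g.card = 2) (h2' : g'.card = 2) (hd : Disjoint g g') :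
    B.card ≤ 4 * (U.card - 2) := by
  obtain ⟨a, b, hab, rfl⟩ := card_eq_two.1 h2
  have key : ∀ x ∈ ({a, b} : Finset ℕ), (B.filter (fun t => x ∈ t)).card ≤ 2 * (U.card - 2) := by
    intro x hxg
    have := pair3_or (F := B) (g := g') (x := x) (m := U.card - 2)
      (fun y hy => pairCount hB x y (by rintro rfl; exact disjoint_left.1 hd hxg hy))
      (fun t ht _ => hx _ hg' t ht)
    rwa [h2'] at this
  have := card_or B (fun t => a ∈ t) (fun t => b ∈ t) (by
    intro t ht; obtain ⟨x, h1, h2⟩ := hx _ hg t ht; grind)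
  have k1 := key a (by simp)
  have k2 := key b (by simp)
  omega

lemma h2five (hB : ∀ b ∈ B, b ⊆ U ∧ b.card = 3) (hG : ∀ g ∈ G, g ⊆ U ∧ g.card = 2)
    (hx : Cross G B) (hno : ∀ a, ∃ b ∈ B, a ∉ b) (h5 : 5 ≤ G.card) :
    B.card ≤ 8 ∨ (G.card ≤ 6 ∧ B.card ≤ U.card + 6) := by
  have hG2 : ∀ g ∈ G, g.card = 2 := fun g hg => (hG g hg).2
  have deg : ∀ a, (G.filter (fun k => a ∈ k)).card ≤ 3 := by
    intro a
    obtain ⟨b, hb, hab⟩ := hno a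
    rw [← (hB b hb).2]
    exact gDeg hG2 hx a hb hab
  have hav : ∀ a, ∃ g ∈ G, a ∉ g := by
    intro a
    by_contra! h
    have := deg a
    rw [filter_true_of_mem h] at this
    omega
  classical
  let Q : Finset ℕ → Prop := fun p => ∀ g ∈ G, ∃ x, x ∈ p ∧ x ∈ g
  -- non-cover part
  have part : (B.filter (fun t => ∀ p ⊆ t, p.card = 2 → ¬ Q p)).card ≤ 8 := by
    set B' := B.filter (fun t => ∀ p ⊆ t, p.card = 2 → ¬ Q p) with hB'
    obtain ⟨g, hg, -⟩ := hav 0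
    have k2 : ∀ x y, x ≠ y → (B'.filter (fun t => x ∈ t ∧ y ∈ t)).card ≤ 2 := by
      intro x y hxy
      rcases (B'.filter (fun t => x ∈ t ∧ y ∈ t)).eq_empty_or_nonempty with h | ⟨t, ht⟩
      · simp [h]
      simp only [mem_filter, hB'] at ht
      have := ht.1.2 {x, y} (by grind) (card_pair hxy)
      simp only [Q] at this
      push Not at this
      obtain ⟨g', hg', hd⟩ := this
      rw [← hG2 g' hg']
      have : B'.filter (fun t => x ∈ t ∧ y ∈ t) ⊆ g'.image (fun z => {x, y, z}) := by
        intro s hs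
        simp only [mem_filter, hB'] at hs
        obtain ⟨z, hz, hzs⟩ := hx g' hg' s hs.1.1
        rw [mem_image]
        have z1 : z ≠ x := by rintro rfl; exact hd z (by simp) hz
        have z2 : z ≠ y := by rintro rfl; exact hd z (by simp) hz
        exact ⟨z, hz, (eq_triple (hB s hs.1.1).2 hs.2.1 hs.2.2 hzs hxy z1.symm z2.symm).symm⟩
      exact (card_le_card this).trans card_image_le
    have k4 : ∀ x, (B'.filter (fun t => x ∈ t)).card ≤ 4 := by
      intro x
      obtain ⟨g', hg', hxg⟩ := hav x
      have := pair3_or (F := B') (g := g') (x := x) (m := 2)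
        (fun y hy => k2 x y (by rintro rfl; exact hxg hy))
        (fun t ht _ => hx g' hg' t (mem_filter.1 ht).1)
      rwa [hG2 g' hg'] at this
    obtain ⟨a, b, hab, rfl⟩ := card_eq_two.1 (hG2 g hg)
    have := card_or B' (fun t => a ∈ t) (fun t => b ∈ t) (by
      intro t ht; obtain ⟨x, h1, h2⟩ := hx _ hg t (mem_filter.1 ht).1; grind)
    have k1 := k4 a
    have k2 := k4 b
    omega
  by_cases hP : ∃ p : Finset ℕ, p.card = 2 ∧ Q p
  · right
    obtain ⟨p, hp2, hpQ⟩ := hP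
    obtain ⟨c, d, hcd, rfl⟩ := card_eq_two.1 hp2
    have uniq : ∀ q : Finset ℕ, q.card = 2 → Q q → q = {c, d} := by
      intro q hq hqQ
      by_contra hne
      let K : Finset (Finset ℕ) := {q, {c, d}}
      have hKG : Cross K G := by
        intro k hk g hg
        simp only [K, mem_insert, mem_singleton] at hk
        rcases hk with rfl | rfl
        · exact hqQ g hg
        · exact hpQ g hg
      rcases two_cases hq hp2 hne with hd | ⟨c', e, e', n1, n2, n3, he1, he2⟩
      · have := gDisj hG2 hKG (k := q) (k' := {c, d}) (by simp [K]) (by simp [K]) hq hp2 hd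
        omega
      · have u1 := card_or G (fun l => c' ∈ l) (fun l => l = {e, e'}) (by
          intro k hk
          obtain ⟨x, hx1, hx2⟩ := hqQ k hk
          obtain ⟨y, hy1, hy2⟩ := hpQ k hk
          rw [he1] at hx1
          rw [he2] at hy1
          by_cases hc : c' ∈ k
          · exact Or.inl hc
          · right
            exact eq_pair (hG2 k hk) (by grind) (by grind) n3)
        have u3 : (G.filter (fun l => l = {e, e'})).card ≤ 1 := by
          refine (card_le_card (t := {{e, e'}}) ?_).trans (by simp)
          intro t ht; simp at ht; simp [ht.2]
        have := deg c'
        omega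
    constructor
    · have := card_or G (fun t => c ∈ t) (fun t => d ∈ t) (by
        intro t ht; obtain ⟨x, h1, h2⟩ := hpQ t ht; grind)
      have := deg c
      have := deg d
      omega
    · have u1 := card_or B (fun t => c ∈ t ∧ d ∈ t) (fun t => ∀ p ⊆ t, p.card = 2 → ¬ Q p) (by
        intro t ht
        by_cases h : c ∈ t ∧ d ∈ t
        · exact Or.inl h
        · right
          intro p hpt hp hpQ
          rw [uniq p hp hpQ] at hpt
          apply h
          constructor <;> apply hpt <;> simp)
      have u2 := pairCount hB c d hcd
      have : 2 ≤ U.card := by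
        obtain ⟨b, hb, -⟩ := hno 0
        have := card_le_card (hB b hb).1
        rw [(hB b hb).2] at this
        omega
      omega
  · left
    push Not at hP
    rwa [filter_true_of_mem (fun t _ p _ hp => hP p hp)] at part

lemma erase_link (F : Finset (Finset ℕ)) (v : ℕ) (hF : ∀ t ∈ F, v ∈ t) :
    (F.image (fun t => t.erase v)).card = F.card := by
  apply card_image_of_injOn
  intro a ha b hb hab
  simp only at hab
  rw [← insert_erase (hF a ha), ← insert_erase (hF b hb), hab]

lemma choose_two_facts (m : ℕ) : (m + 1).choose 2 = m.choose 2 + m := by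
  rw [Nat.choose_succ_succ' m 1]; simp; ring

lemma cubic_aux (N : ℕ) (hN : 7 ≤ N) : 6 * N - 12 ≤ N.choose 2 + N + 3 := by
  induction N, hN using Nat.le_induction with
  | base => decide
  | succ k hk ih => rw [choose_two_facts]; omega

/-- case of one cover pair -/
lemma oneCover (hB : ∀ b ∈ B, b ⊆ U ∧ b.card = 3) (hfree : P4Free B) {a b : ℕ} (hab : a ≠ b)
    (hU : a ∈ U ∧ b ∈ U)
    (hc : ∀ t ∈ B, a ∈ t ∨ b ∈ t) :
    B.card ≤ (U.card - 2) * (U.card - 2) ∧ (9 ≤ U.card → B.card ≤ U.card.choose 2 + 2) := by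
  obtain ⟨haU, hbU⟩ := hU
  set A' := B.filter (fun t => a ∈ t ∧ b ∉ t) with hA'
  set B' := B.filter (fun t => b ∈ t ∧ a ∉ t) with hB'
  set W := U \ {a, b} with hW
  have hWc : W.card = U.card - 2 := by
    rw [hW, card_sdiff_of_subset (by grind), card_pair hab]
  set La := A'.image (fun t => t.erase a) with hLa
  set Lb := B'.image (fun t => t.erase b) with hLb
  have cA : La.card = A'.card := erase_link _ _ (by intro t ht; simp [hA'] at ht; exact ht.2.1)
  have cB : Lb.card = B'.card := erase_link _ _ (by intro t ht; simp [hB'] at ht; exact ht.2.1)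
  have tot : B.card ≤ (U.card - 2) + (A'.card + B'.card) := by
    have h1 := card_or B (fun t => a ∈ t ∧ b ∈ t) (fun t => (a ∈ t ∧ b ∉ t) ∨ (b ∈ t ∧ a ∉ t)) (by
      intro t ht; have := hc t ht; tauto)
    have h2 := pairCount hB a b hab
    rw [filter_or, ← hA', ← hB'] at h1
    have := card_union_le A' B'
    omega
  have mLa : ∀ l ∈ La, l ⊆ W ∧ l.card = 2 ∧ insert a l ∈ B := by
    intro l hl
    simp only [hLa, mem_image, hA', mem_filter] at hl
    obtain ⟨t, ⟨ht, h1, h2⟩, rfl⟩ := hl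
    refine ⟨?_, ?_, ?_⟩
    · have := (hB t ht).1; intro x hx; grind
    · rw [card_erase_of_mem h1, (hB t ht).2]
    · rwa [insert_erase h1]
  have mLb : ∀ l ∈ Lb, l ⊆ W ∧ l.card = 2 ∧ insert b l ∈ B := by
    intro l hl
    simp only [hLb, mem_image, hB', mem_filter] at hl
    obtain ⟨t, ⟨ht, h1, h2⟩, rfl⟩ := hl
    refine ⟨?_, ?_, ?_⟩
    · have := (hB t ht).1; intro x hx; grind
    · rw [card_erase_of_mem h1, (hB t ht).2]
    · rwa [insert_erase h1]
  have sA : La ⊆ powersetCard 2 W := fun l hl => mem_powersetCard.2 ⟨(mLa l hl).1, (mLa l hl).2.1⟩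
  have sB : Lb ⊆ powersetCard 2 W := fun l hl => mem_powersetCard.2 ⟨(mLb l hl).1, (mLb l hl).2.1⟩
  have c1 := card_le_card sA
  have c2 := card_le_card sB
  rw [card_powersetCard] at c1 c2
  have haW : a ∉ W := by simp [hW]
  have hbW : b ∉ W := by simp [hW]
  -- path
  have path : ∀ e0 ∈ La, ∀ e ∈ La, e ∈ Lb → ∀ f ∈ Lb, Disjoint e0 e → Disjoint e0 f → Disjoint e f →
      False := by
    intro e0 h0 e he he' f hf d1 d2 d3
    obtain ⟨x, y, hxy, hexy⟩ := card_eq_two.1 (mLa e he).2.1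
    have q1 : a ∉ f := fun h => haW ((mLb f hf).1 h)
    have q2 : b ∉ e0 := fun h => hbW ((mLa e0 h0).1 h)
    have q3 : b ∉ e := fun h => hbW ((mLa e he).1 h)
    have q4 : a ∉ e := fun h => haW ((mLa e he).1 h)
    refine nopath hfree a x b (mLa e0 h0).2.2 (mLa e he).2.2 (mLb e he').2.2 (mLb f hf).2.2
      (by simp) (by simp [hexy]) (by simp) ?_ ?_ ?_ <;>
    · simp only [disjoint_insert_left, disjoint_insert_right, mem_insert]
      grind
  have hN : W.card * W.card = 2 * W.card.choose 2 + W.card := by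
    have := Nat.triangle_succ (W.card - 1)
    rcases Nat.eq_zero_or_pos W.card with h | h
    · simp [h]
    · rw [Nat.choose_two_right]
      have h2 : 2 ∣ W.card * (W.card - 1) := (Nat.even_mul_pred_self _).two_dvd
      rw [Nat.mul_div_cancel' h2]
      obtain ⟨k, hk⟩ : ∃ k, W.card = k + 1 := ⟨W.card - 1, by omega⟩
      rw [hk]; simp; ring
  refine ⟨?_, ?_⟩
  · rw [← hWc, hN]; omega
  · intro h9
    have hU2 : U.card.choose 2 = W.card.choose 2 + W.card + (W.card + 1) := by
      rw [← choose_two_facts, ← choose_two_facts, hWc]; congr 1; omega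
    rw [hU2]
    by_cases hI : ∃ e ∈ La ∩ Lb, ∃ e' ∈ La ∩ Lb, Disjoint e e'
    · obtain ⟨e, he, e', he', hd⟩ := hI
      rw [mem_inter] at he he'
      have eW := (mLa e he.1)
      have cr : Cross {e} (La.filter (fun l => ¬ Disjoint l e)) ∧
          Cross {e} (Lb.filter (fun l => ¬ Disjoint l e)) := by
        constructor <;>
        · intro k hk l hl
          rw [mem_filter, not_disjoint_iff] at hl
          rw [mem_singleton] at hk
          subst hk
          obtain ⟨x, h1, h2⟩ := hl.2
          exact ⟨x, h2, h1⟩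
      have b1 := gA (W := W) (K := {e}) (L := La.filter (fun l => ¬ Disjoint l e))
        (by simp [eW.1, eW.2.1]) (fun l hl => ⟨(mLa l (mem_filter.1 hl).1).1, (mLa l (mem_filter.1 hl).1).2.1⟩)
        cr.1 (by simp)
      have b2 := gA (W := W) (K := {e}) (L := Lb.filter (fun l => ¬ Disjoint l e))
        (by simp [eW.1, eW.2.1]) (fun l hl => ⟨(mLb l (mem_filter.1 hl).1).1, (mLb l (mem_filter.1 hl).1).2.1⟩)
        cr.2 (by simp)
      have b3 := cross2 (W := W \ e) (K := La.filter (fun l => Disjoint l e))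
        (L := Lb.filter (fun l => Disjoint l e))
        (fun l hl => by
          rw [mem_filter] at hl
          exact ⟨subset_sdiff.2 ⟨(mLa l hl.1).1, hl.2⟩, (mLa l hl.1).2.1⟩)
        (fun l hl => by
          rw [mem_filter] at hl
          exact ⟨subset_sdiff.2 ⟨(mLb l hl.1).1, hl.2⟩, (mLb l hl.1).2.1⟩)
        (by
          intro k hk l hl
          rw [mem_filter] at hk hl
          by_contra! hcon
          exact path k hk.1 e he.1 he.2 l hl.1 hk.2 (disjoint_left.2 hcon) hl.2.symm)
        ⟨e', by simp [he'.1, hd.symm]⟩ ⟨e', by simp [he'.2, hd.symm]⟩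
      rw [card_sdiff_of_subset eW.1, eW.2.1] at b3
      have e1 := card_or La (fun l => Disjoint l e) (fun l => ¬ Disjoint l e) (fun l _ => em _)
      have e2 := card_or Lb (fun l => Disjoint l e) (fun l => ¬ Disjoint l e) (fun l _ => em _)
      have := cubic_aux W.card (by omega)
      omega
    · push Not at hI
      have u1 := card_union_add_card_inter La Lb
      have u2 := card_le_card (union_subset sA sB)
      rw [card_powersetCard] at u2
      have u3 : (La ∩ Lb).card ≤ W.card := by
        have hx : Cross (La ∩ Lb) (La ∩ Lb) := fun k hk l hl => not_disjoint_iff.1 (hI k hk l hl)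
        have hh : ∀ l ∈ La ∩ Lb, l ⊆ W ∧ l.card = 2 := fun l hl =>
          ⟨(mLa l (mem_inter.1 hl).1).1, (mLa l (mem_inter.1 hl).1).2.1⟩
        have := gB hh hh hx
        omega
      omega

lemma tau2 (hB : ∀ b ∈ B, b ⊆ U ∧ b.card = 3) (hG : ∀ g ∈ G, g ⊆ U ∧ g.card = 2)
    (hx : Cross G B) (hno : ∀ a, ∃ b ∈ B, a ∉ b) (hfree : P4Free B) (h1 : G.Nonempty) :
    (G.card ≤ 9 ∧ B.card ≤ 8) ∨ (G.card ≤ 6 ∧ B.card ≤ U.card + 6) ∨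
    (G.card ≤ 4 ∧ B.card ≤ 4 * (U.card - 2)) ∨
    (G.card ≤ 3 ∧ B.card ≤ (U.card - 1).choose 2 + 1) ∨
    (G.card ≤ 2 ∧ B.card ≤ (U.card - 1).choose 2 + (U.card - 3)) ∨
    (G.card ≤ 1 ∧ B.card ≤ (U.card - 2) * (U.card - 2) ∧ (9 ≤ U.card → B.card ≤ U.card.choose 2 + 2)) := by
  have hG2 : ∀ g ∈ G, g.card = 2 := fun g hg => (hG g hg).2
  have hB3 : ∀ g ∈ B, g.card = 3 := fun g hg => (hB g hg).2
  have tot := gTot hG2 hx hB3 hno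
  by_cases h5 : 5 ≤ G.card
  · rcases h2five hB hG hx hno h5 with h | h
    · exact Or.inl ⟨tot, h⟩
    · exact Or.inr (Or.inl h)
  by_cases hd : ∃ g ∈ G, ∃ g' ∈ G, Disjoint g g'
  · obtain ⟨g, hg, g', hg', hd⟩ := hd
    right; right; left
    exact ⟨by omega, h3disj hB hx hg hg' (hG2 g hg) (hG2 g' hg') hd⟩
  push Not at hd
  by_cases hc1 : G.card ≤ 1
  · obtain ⟨g, hg⟩ := h1
    obtain ⟨a, b, hab, rfl⟩ := card_eq_two.1 (hG2 g hg)
    have := oneCover hB hfree hab ⟨(hG _ hg).1 (by simp), (hG _ hg).1 (by simp)⟩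
      (by intro t ht; obtain ⟨x, h1, h2⟩ := hx _ hg t ht; grind)
    grind
  obtain ⟨k, hk, k', hk', hkk⟩ := one_lt_card.1 (show 1 < G.card by omega)
  rcases two_cases (hG2 k hk) (hG2 k' hk') hkk with hdd | ⟨c, d, d', n1, n2, n3, rfl, rfl⟩
  · exact absurd hdd (hd _ hk _ hk')
  by_cases hc2 : G.card ≤ 2
  · right; right; right; right; left
    refine ⟨hc2, ?_⟩
    have := card_or B (fun t => c ∈ t) (fun t => d ∈ t ∧ d' ∈ t ∧ c ∉ t) (by
      intro t ht
      obtain ⟨x, hx1, hx2⟩ := hx _ hk t ht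
      obtain ⟨y, hy1, hy2⟩ := hx _ hk' t ht
      grind)
    have s1 := starCount hB c
    have s2 := pair3 (W := U.erase c) (F := B.filter (fun t => d ∈ t ∧ d' ∈ t ∧ c ∉ t)) d d' n3 (by
      intro t ht; rw [mem_filter] at ht
      exact ⟨subset_erase.2 ⟨(hB t ht.1).1, ht.2.2.2⟩, hB3 t ht.1, ht.2.1, ht.2.2.1⟩)
    rw [card_erase_of_mem ((hG _ hk).1 (by simp))] at s2
    omega
  -- third element
  obtain ⟨k'', hk'', hne1, hne2⟩ : ∃ k'' ∈ G, k'' ≠ {c, d} ∧ k'' ≠ {c, d'} := by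
    by_contra! hcon
    have := card_le_card (show G ⊆ {{c, d}, {c, d'}} by
      intro g hg
      by_cases h : g = {c, d}
      · simp [h]
      · simp [hcon g hg h])
    have := this.trans card_le_two
    omega
  by_cases hc : c ∈ k''
  · -- star
    have hcall : ∀ g ∈ G, c ∈ g := by
      intro g hg
      by_contra hcg
      have a1 := not_disjoint_iff.1 (hd _ hk _ hg)
      have a2 := not_disjoint_iff.1 (hd _ hk' _ hg)
      have a3 := not_disjoint_iff.1 (hd _ hk'' _ hg)
      obtain ⟨x, hx1, hx2⟩ := a1
      obtain ⟨y, hy1, hy2⟩ := a2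
      obtain ⟨z, hz1, hz2⟩ := a3
      have : g = {d, d'} := eq_pair (hG2 g hg) (by grind) (by grind) n3
      have e4 := eq_pair (hG2 _ hk'') hc hz1 (by grind)
      grind
    right; right; right; left
    constructor
    · obtain ⟨b, hb, hcb⟩ := hno c
      have := gDeg hG2 hx c hb hcb
      rw [filter_true_of_mem hcall, hB3 b hb] at this
      exact this
    · obtain ⟨d'', hd''⟩ : ∃ d'', c ≠ d'' ∧ k'' = {c, d''} := by
        obtain ⟨x, y, hxy, rfl⟩ := card_eq_two.1 (hG2 _ hk'')
        simp only [mem_insert, mem_singleton] at hc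
        rcases hc with rfl | rfl
        · exact ⟨y, hxy, rfl⟩
        · exact ⟨x, hxy.symm, pair_comm _ _⟩
      obtain ⟨n4, rfl⟩ := hd''
      have n5 : d ≠ d'' := by grind
      have n6 : d' ≠ d'' := by grind
      have := card_or B (fun t => c ∈ t) (fun t => t = {d, d', d''}) (by
        intro t ht
        obtain ⟨x, hx1, hx2⟩ := hx _ hk t ht
        obtain ⟨y, hy1, hy2⟩ := hx _ hk' t ht
        obtain ⟨z, hz1, hz2⟩ := hx _ hk'' t ht
        by_cases hct : c ∈ t
        · exact Or.inl hct
        · right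
          exact eq_triple (hB3 t ht) (by grind) (by grind) (by grind) n3 n5 n6)
      have s1 := starCount hB c
      have s2 : (B.filter (fun t => t = {d, d', d''})).card ≤ 1 := by
        refine (card_le_card (t := {{d, d', d''}}) ?_).trans (by simp)
        intro t ht; simp at ht; simp [ht.2]
      omega
  · right; right; left
    refine ⟨by omega, ?_⟩
    have e4 : k'' = {d, d'} := by
      have a1 := hd _ hk _ hk''
      have a2 := hd _ hk' _ hk''
      rw [not_disjoint_iff] at a1 a2
      obtain ⟨x, hx1, hx2⟩ := a1
      obtain ⟨y, hy1, hy2⟩ := a2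
      exact eq_pair (hG2 _ hk'') (by grind) (by grind) n3
    subst e4
    have s0 := card_or B (fun t => c ∈ t ∧ d ∈ t) (fun t => (c ∈ t ∧ d' ∈ t) ∨ (d ∈ t ∧ d' ∈ t)) (by
      intro t ht
      obtain ⟨x, hx1, hx2⟩ := hx _ hk t ht
      obtain ⟨y, hy1, hy2⟩ := hx _ hk' t ht
      obtain ⟨z, hz1, hz2⟩ := hx _ hk'' t ht
      grind)
    rw [filter_or] at s0
    have s1 := card_union_le (B.filter (fun t => c ∈ t ∧ d' ∈ t)) (B.filter (fun t => d ∈ t ∧ d' ∈ t))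
    have s2 := pairCount hB c d n1
    have s3 := pairCount hB c d' n2
    have s4 := pairCount hB d d' n3
    omega

end tau2

def Good (n k : ℕ) : Prop :=
  (12 ≤ n → k ≤ (n - 3).choose 2 + 6) ∧ (n = 7 → k ≤ 30) ∧ (n = 8 → k ≤ 38) ∧
    (n = 9 → k ≤ 41) ∧ (n = 10 → k ≤ 50) ∧ (n = 11 → k ≤ 60)

def Out (V : Finset ℕ) (H : Finset (Finset ℕ)) : Prop :=
  SubStarPlus V H ∨ SubCB V H ∨ Good V.card H.card

def Tstar (n : ℕ) : ℕ :=
  if n ≤ 6 then n.choose 3 else if n = 7 then 30 else if n = 8 then 38 else if n = 9 then 41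
  else if n = 10 then 50 else if n = 11 then 60 else (n - 1).choose 2 + 1

lemma choose_lb (n : ℕ) (h : 12 ≤ n) : 9 * n ≤ (n - 3).choose 2 + 72 := by
  induction n, h using Nat.le_induction with
  | base => decide
  | succ k hk ih =>
    have := choose_two_facts (k - 3)
    rw [show k + 1 - 3 = (k - 3) + 1 by omega]
    omega

lemma good_mono {n k k' : ℕ} (h : Good n k) (hk : k' ≤ k) : Good n k' := by
  unfold Good at *; omega

lemma choose_add (m j : ℕ) : (m + j).choose 2 = m.choose 2 + j.choose 2 + m * j := by
  induction j with
  | zero => simp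
  | succ j ih => rw [← add_assoc, choose_two_facts, choose_two_facts, ih]; ring

lemma conv (a b c : ℕ) (ha : c ≤ a) (hb : c ≤ b) :
    a.choose 2 + b.choose 2 ≤ c.choose 2 + (a + b - c).choose 2 := by
  obtain ⟨i, rfl⟩ := Nat.exists_eq_add_of_le ha
  obtain ⟨j, rfl⟩ := Nat.exists_eq_add_of_le hb
  rw [show c + i + (c + j) - c = c + i + j by omega]
  rw [choose_add c j, choose_add (c + i) j]
  nlinarith [Nat.zero_le (i * j)]

lemma choose_mono2 {a b : ℕ} (h : a ≤ b) : a.choose 2 ≤ b.choose 2 := Nat.choose_le_choose 2 h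

lemma Tsum (a b : ℕ) (ha : 3 ≤ a) (hb : 3 ≤ b) : Good (a + b) (Tstar a + Tstar b) := by
  have key : ∀ a b, 3 ≤ a → a ≤ 11 → 12 ≤ b → Good (a + b) (Tstar a + Tstar b) := by
    intro a b ha ha' hb
    have hT : Tstar a + 1 ≤ 11 * (a - 2) + 6 := by
      interval_cases a <;> decide
    have hTb : Tstar b = (b - 1).choose 2 + 1 := by unfold Tstar; split_ifs <;> omega
    have h1 := choose_add (b - 1) (a - 2)
    have h2 : 11 * (a - 2) ≤ (b - 1) * (a - 2) := Nat.mul_le_mul_right _ (by omega)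
    rw [show b - 1 + (a - 2) = a + b - 3 by omega] at h1
    unfold Good; omega
  rcases le_or_gt a 11 with h1 | h1 <;> rcases le_or_gt b 11 with h2 | h2
  · have : ∀ a ∈ Finset.Icc 3 11, ∀ b ∈ Finset.Icc 3 11, Good (a + b) (Tstar a + Tstar b) := by
      unfold Good
      decide
    exact this a (by simp; omega) b (by simp; omega)
  · exact key a b ha h1 h2
  · rw [add_comm a b, add_comm (Tstar a)]; exact key b a hb h2 h1
  · have hTa : Tstar a = (a - 1).choose 2 + 1 := by unfold Tstar; split_ifs <;> omega
    have hTb : Tstar b = (b - 1).choose 2 + 1 := by unfold Tstar; split_ifs <;> omega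
    have h3 := conv (a - 1) (b - 1) 2 (by omega) (by omega)
    have h4 : (a - 1 + (b - 1) - 2).choose 2 ≤ (a + b - 3).choose 2 := choose_mono2 (by omega)
    have : Nat.choose 2 2 = 1 := rfl
    unfold Good; omega

lemma subStarPlus_card {V : Finset ℕ} {H : Finset (Finset ℕ)} (h : SubStarPlus V H) :
    H.card ≤ (V.card - 1).choose 2 + 1 := by
  obtain ⟨H', ⟨v, hv, e, he, he3, hve, rfl⟩, hH⟩ := h
  refine (card_le_card hH).trans ((card_union_le _ _).trans ?_)
  have := star3 (W := V) (F := (V.powersetCard 3).filter (fun t => v ∈ t)) v (by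
    intro t ht; simp only [mem_filter, mem_powersetCard] at ht; exact ⟨ht.1.1, ht.1.2, ht.2⟩)
  simpa using this

lemma CB_card_le {V : Finset ℕ} {H : Finset (Finset ℕ)} (h : IsCBOn V H) :
    H.card ≤ (V.card - 3).choose 2 + 7 := by
  obtain ⟨x, y1, y2, z1, z2, hV, h5, rfl⟩ := h
  refine (card_union_le _ _).trans ?_
  have := star3 (W := V \ {z1, z2}) (F := ((V \ {z1, z2}).powersetCard 3).filter (fun t => x ∈ t)) x (by
    intro t ht; simp only [mem_filter, mem_powersetCard] at ht; exact ⟨ht.1.1, ht.1.2, ht.2⟩)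
  have hz : z1 ≠ z2 := by
    rintro rfl
    have : ({x, y1, y2, z1, z1} : Finset ℕ).card ≤ 4 := by
      simp only [pair_eq_singleton]; exact card_le_four
    omega
  rw [card_sdiff_of_subset (by grind), card_pair hz] at this
  have h7 : ({{y1, y2, z1}, {y1, y2, z2}, {x, y1, z1}, {x, y1, z2},
        {x, y2, z1}, {x, y2, z2}, {x, z1, z2}} : Finset (Finset ℕ)).card ≤ 7 := by
    refine (card_insert_le _ _).trans (Nat.succ_le_succ card_le_six)
  rw [show V.card - 3 = V.card - 2 - 1 by omega]
  omega

lemma out_T {V : Finset ℕ} {H : Finset (Finset ℕ)} (h3 : ThreeGraphOn V H)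
    (h : 7 ≤ V.card → Out V H) : H.card ≤ Tstar V.card := by
  rcases le_or_gt V.card 6 with h6 | h6
  · unfold Tstar
    rw [if_pos h6, ← card_powersetCard]
    exact card_le_card fun e he => mem_powersetCard.2 (h3 e he)
  · have hT : (V.card - 1).choose 2 + 1 ≤ Tstar V.card := by
      rcases le_or_gt V.card 11 with h11 | h11
      · generalize V.card = n at *
        interval_cases n <;> decide
      · unfold Tstar; split_ifs <;> omega
    rcases h h6 with h | ⟨H', h1, h2⟩ | h
    · exact (subStarPlus_card h).trans hT
    · refine ((card_le_card h2).trans (CB_card_le h1)).trans (le_trans ?_ hT)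
      have a1 := choose_two_facts (V.card - 3)
      have a2 := choose_two_facts (V.card - 2)
      rw [show V.card - 3 + 1 = V.card - 2 by omega] at a1
      rw [show V.card - 2 + 1 = V.card - 1 by omega] at a2
      omega
    · have a1 := choose_mono2 (show V.card - 3 ≤ V.card - 1 by omega)
      have a2 := choose_two_facts (V.card - 3)
      have a3 := choose_two_facts (V.card - 2)
      rw [show V.card - 3 + 1 = V.card - 2 by omega] at a2
      rw [show V.card - 2 + 1 = V.card - 1 by omega] at a3
      unfold Good at h
      unfold Tstar
      split_ifs <;> omega

lemma star_out {V : Finset ℕ} {H : Finset (Finset ℕ)} (h3 : ThreeGraphOn V H) (hn : 7 ≤ V.card)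
    (v : ℕ) (hv : v ∈ V) (e : Finset ℕ) (h : ∀ t ∈ H, v ∈ t ∨ t = e) : SubStarPlus V H := by
  by_cases he : e ⊆ V ∧ e.card = 3 ∧ v ∉ e
  · refine ⟨_, ⟨v, hv, e, he.1, he.2.1, he.2.2, rfl⟩, ?_⟩
    intro t ht
    have := h3 t ht
    simp only [mem_union, mem_filter, mem_powersetCard, mem_singleton]
    rcases h t ht with h' | h'
    · exact Or.inl ⟨this, h'⟩
    · exact Or.inr h'
  · obtain ⟨e', he', he3⟩ := exists_subset_card_eq (s := V.erase v) (n := 3) (by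
      rw [card_erase_of_mem hv]; omega)
    have : v ∉ e' := fun h => by simpa using he' h
    refine ⟨_, ⟨v, hv, e', he'.trans (erase_subset _ _), he3, this, rfl⟩, ?_⟩
    intro t ht
    have h4 := h3 t ht
    simp only [mem_union, mem_filter, mem_powersetCard, mem_singleton]
    left
    refine ⟨h4, ?_⟩
    rcases h t ht with h' | rfl
    · exact h'
    · by_contra hvt; exact he ⟨h4.1, h4.2, hvt⟩

lemma inter_case {V : Finset ℕ} {H : Finset (Finset ℕ)} (h3 : ThreeGraphOn V H) (hn : 7 ≤ V.card)
    (hi : ∀ e ∈ H, ∀ f ∈ H, ¬ Disjoint e f) : Out V H := by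
  by_cases hs : ∃ v ∈ V, ∀ t ∈ H, v ∈ t
  · obtain ⟨v, hv, hs⟩ := hs
    exact Or.inl (star_out h3 hn v hv ∅ fun t ht => Or.inl (hs t ht))
  push Not at hs
  have hs' : ∀ v, ∃ t ∈ H, v ∉ t := by
    intro v
    by_cases hv : v ∈ V
    · exact hs v hv
    · obtain ⟨w, hw⟩ := card_pos.1 (show 0 < V.card by omega)
      obtain ⟨t, ht, -⟩ := hs w hw
      exact ⟨t, ht, fun h => hv ((h3 t ht).1 h)⟩
  right; right
  have hx : ∀ e ∈ H, ∀ f ∈ H, ∃ x, x ∈ e ∧ x ∈ f := fun e he f hf => not_disjoint_iff.1 (hi e he f hf)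
  by_cases hp : ∃ a b, a ≠ b ∧ ∀ t ∈ H, a ∈ t ∨ b ∈ t
  · obtain ⟨a, b, hab, hc⟩ := hp
    obtain ⟨ta, hta, hata⟩ := hs' b
    obtain ⟨tb, htb, hbtb⟩ := hs' a
    have ha : a ∈ ta := by have := hc ta hta; tauto
    have hb : b ∈ tb := by have := hc tb htb; tauto
    have haV := (h3 ta hta).1 ha
    have hbV := (h3 tb htb).1 hb
    set A' := H.filter (fun t => a ∈ t ∧ b ∉ t) with hA'
    set B' := H.filter (fun t => b ∈ t ∧ a ∉ t) with hB'
    have cA := erase_link A' a (by intro t ht; simp [hA'] at ht; exact ht.2.1)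
    have cB := erase_link B' b (by intro t ht; simp [hB'] at ht; exact ht.2.1)
    have mA : ∀ l ∈ A'.image (fun t => t.erase a), l ⊆ V \ {a, b} ∧ l.card = 2 := by
      intro l hl
      simp only [mem_image, hA', mem_filter] at hl
      obtain ⟨t, ⟨ht, h1, h2⟩, rfl⟩ := hl
      refine ⟨?_, ?_⟩
      · have := (h3 t ht).1; intro x hx; grind
      · rw [card_erase_of_mem h1, (h3 t ht).2]
    have mB : ∀ l ∈ B'.image (fun t => t.erase b), l ⊆ V \ {a, b} ∧ l.card = 2 := by
      intro l hl
      simp only [mem_image, hB', mem_filter] at hl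
      obtain ⟨t, ⟨ht, h1, h2⟩, rfl⟩ := hl
      refine ⟨?_, ?_⟩
      · have := (h3 t ht).1; intro x hx; grind
      · rw [card_erase_of_mem h1, (h3 t ht).2]
    have hcr : Cross (A'.image (fun t => t.erase a)) (B'.image (fun t => t.erase b)) := by
      intro k hk l hl
      simp only [mem_image, hA', hB', mem_filter] at hk hl
      obtain ⟨t, ⟨ht, h1, h2⟩, rfl⟩ := hk
      obtain ⟨s, ⟨hs, h1', h2'⟩, rfl⟩ := hl
      obtain ⟨x, x1, x2⟩ := hx t ht s hs
      exact ⟨x, by grind, by grind⟩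
    have c2 := cross2 mA mB hcr ⟨_, mem_image_of_mem _ (show ta ∈ A' by simp [hA', hta, ha, hata])⟩
      ⟨_, mem_image_of_mem _ (show tb ∈ B' by simp [hB', htb, hb, hbtb])⟩
    rw [card_sdiff_of_subset (by grind), card_pair hab, cA, cB] at c2
    have h1 := card_or H (fun t => a ∈ t ∧ b ∈ t) (fun t => (a ∈ t ∧ b ∉ t) ∨ (b ∈ t ∧ a ∉ t)) (by
      intro t ht; have := hc t ht; tauto)
    have h2 := pairCount h3 a b hab
    rw [filter_or, ← hA', ← hB'] at h1
    have h4 := card_union_le A' B'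
    have := choose_lb V.card
    unfold Good; omega
  · push Not at hp
    have p2 : ∀ x y, x ≠ y → (H.filter (fun t => x ∈ t ∧ y ∈ t)).card ≤ 3 := by
      intro x y hxy
      obtain ⟨g, hg, g1, g2⟩ := hp x y hxy
      rw [← (h3 g hg).2]
      refine (card_le_card (t := g.image (fun z => {x, y, z})) ?_).trans card_image_le
      intro s hs
      simp only [mem_filter] at hs
      obtain ⟨z, hz, hzs⟩ := hx g hg s hs.1
      rw [mem_image]
      exact ⟨z, hz, (eq_triple (h3 s hs.1).2 hs.2.1 hs.2.2 hzs hxy (by grind) (by grind)).symm⟩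
    have p1 : ∀ x, (H.filter (fun t => x ∈ t)).card ≤ 9 := by
      intro x
      obtain ⟨f, hf, hxf⟩ := hs' x
      have := pair3_or (F := H) (g := f) (x := x) (m := 3)
        (fun y hy => p2 x y (by rintro rfl; exact hxf hy))
        (fun t ht _ => hx f hf t ht)
      rwa [(h3 f hf).2] at this
    obtain ⟨e, he, -⟩ := hs' 0
    have : H.card ≤ e.card * 9 := by
      refine (card_le_card (t := e.biUnion (fun x => H.filter (fun t => x ∈ t))) ?_).trans
        (card_biUnion_le_card_mul _ _ _ fun x _ => p1 x)
      intro t ht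
      obtain ⟨x, x1, x2⟩ := hx e he t ht
      simp only [mem_biUnion, mem_filter]
      exact ⟨x, x1, ht, x2⟩
    rw [(h3 e he).2] at this
    have := choose_lb V.card
    unfold Good; omega

lemma disc_case {V : Finset ℕ} {H B₁ B₂ : Finset (Finset ℕ)} (h3 : ThreeGraphOn V H)
    (hfree : P4Free H)
    (ih : ∀ V' H', V'.card < V.card → ThreeGraphOn V' H' → P4Free H' → H'.card ≤ Tstar V'.card)
    (hH : H = B₁ ∪ B₂) (n1 : B₁.Nonempty) (n2 : B₂.Nonempty)
    (hd : ∀ a ∈ B₁, ∀ b ∈ B₂, Disjoint a b) : Out V H := by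
  right; right
  have m1 : ∀ b ∈ B₁, b ∈ H := fun b hb => by simp [hH, hb]
  have m2 : ∀ b ∈ B₂, b ∈ H := fun b hb => by simp [hH, hb]
  have sub : ∀ B ⊆ H, P4Free B := by
    rintro B hB ⟨a, ha, b, hb, c, hc, d, hd, h⟩
    exact hfree ⟨a, hB ha, b, hB hb, c, hB hc, d, hB hd, h⟩
  set U := B₁.biUnion id with hU
  have hUV : U ⊆ V := by
    intro x hx; simp only [hU, mem_biUnion, id] at hx
    obtain ⟨b, hb, hxb⟩ := hx
    exact (h3 b (m1 b hb)).1 hxb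
  have s1 : ∀ b ∈ B₁, b ⊆ U := fun b hb => subset_biUnion_of_mem id hb
  have s2 : ∀ b ∈ B₂, b ⊆ V \ U := by
    intro b hb x hx
    rw [mem_sdiff]
    refine ⟨(h3 b (m2 b hb)).1 hx, ?_⟩
    simp only [hU, mem_biUnion, id]
    rintro ⟨a, ha, hxa⟩
    exact disjoint_left.1 (hd a ha b hb) hxa hx
  have c1 : 3 ≤ U.card := by
    obtain ⟨b, hb⟩ := n1
    rw [← (h3 b (m1 b hb)).2]; exact card_le_card (s1 b hb)
  have c2 : 3 ≤ (V \ U).card := by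
    obtain ⟨b, hb⟩ := n2
    rw [← (h3 b (m2 b hb)).2]; exact card_le_card (s2 b hb)
  have c3 : (V \ U).card + U.card = V.card := card_sdiff_add_card_eq_card hUV
  have i1 := ih U B₁ (by omega) (fun e he => ⟨s1 e he, (h3 e (m1 e he)).2⟩) (sub _ m1)
  have i2 := ih (V \ U) B₂ (by omega) (fun e he => ⟨s2 e he, (h3 e (m2 e he)).2⟩) (sub _ m2)
  have := Tsum _ _ c2 c1
  rw [c3] at this
  apply good_mono this
  rw [hH]
  refine (card_union_le _ _).trans ?_
  omega

def UU (B : Finset (Finset ℕ)) : Finset ℕ := B.biUnion id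
def cen (B : Finset (Finset ℕ)) : Finset ℕ := (UU B).filter (fun x => ∀ b ∈ B, x ∈ b)
def Cov (B : Finset (Finset ℕ)) : Finset (Finset ℕ) :=
  ((UU B).powersetCard 2).filter (fun g => Disjoint g (cen B) ∧ ∀ b ∈ B, ∃ x, x ∈ g ∧ x ∈ b)

structure Setup (V : Finset ℕ) (H B₁ B₂ C : Finset (Finset ℕ)) : Prop where
  h3 : ThreeGraphOn V H
  hfree : P4Free H
  hn : 7 ≤ V.card
  hH : H = B₁ ∪ B₂ ∪ C
  n1 : B₁.Nonempty
  n2 : B₂.Nonempty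
  hd : ∀ a ∈ B₁, ∀ b ∈ B₂, Disjoint a b
  hc : ∀ c ∈ C, ∀ b ∈ B₁ ∪ B₂, ∃ x, x ∈ c ∧ x ∈ b
  hC : C.Nonempty

section
variable {V : Finset ℕ} {H B₁ B₂ C : Finset (Finset ℕ)}

lemma Setup.symm (S : Setup V H B₁ B₂ C) : Setup V H B₂ B₁ C where
  h3 := S.h3
  hfree := S.hfree
  hn := S.hn
  hH := by rw [S.hH, union_comm B₁ B₂]
  n1 := S.n2
  n2 := S.n1
  hd := fun a ha b hb => (S.hd b hb a ha).symm
  hc := fun c hc b hb => S.hc c hc b (by rwa [union_comm])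
  hC := S.hC

lemma Setup.m1 (S : Setup V H B₁ B₂ C) : ∀ b ∈ B₁, b ∈ H := fun b hb => by simp [S.hH, hb]
lemma Setup.m2 (S : Setup V H B₁ B₂ C) : ∀ b ∈ B₂, b ∈ H := fun b hb => by simp [S.hH, hb]
lemma Setup.m3 (S : Setup V H B₁ B₂ C) : ∀ b ∈ C, b ∈ H := fun b hb => by simp [S.hH, hb]

lemma Setup.card_le (S : Setup V H B₁ B₂ C) : H.card ≤ B₁.card + B₂.card + C.card := by
  rw [S.hH]
  have := card_union_le (B₁ ∪ B₂) C
  have := card_union_le B₁ B₂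
  omega

lemma mem_UU {B : Finset (Finset ℕ)} {x : ℕ} : x ∈ UU B ↔ ∃ b ∈ B, x ∈ b := by simp [UU]
lemma sub_UU {B : Finset (Finset ℕ)} {b : Finset ℕ} (hb : b ∈ B) : b ⊆ UU B :=
  fun x hx => mem_UU.2 ⟨b, hb, hx⟩

lemma mem_cen {B : Finset (Finset ℕ)} (hB : B.Nonempty) {x : ℕ} : x ∈ cen B ↔ ∀ b ∈ B, x ∈ b := by
  simp only [cen, mem_filter, mem_UU]
  constructor
  · exact fun h => h.2
  · intro h; obtain ⟨b, hb⟩ := hB; exact ⟨⟨b, hb, h b hb⟩, h⟩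

lemma cen_sub {B : Finset (Finset ℕ)} {b : Finset ℕ} (hb : b ∈ B) : cen B ⊆ b := by
  intro x hx; exact (mem_filter.1 hx).2 b hb

lemma mem_Cov {B : Finset (Finset ℕ)} {g : Finset ℕ} : g ∈ Cov B ↔ g ⊆ UU B ∧ g.card = 2 ∧
    Disjoint g (cen B) ∧ ∀ b ∈ B, ∃ x, x ∈ g ∧ x ∈ b := by
  simp [Cov, mem_powersetCard, and_assoc]

lemma Setup.dUU (S : Setup V H B₁ B₂ C) : Disjoint (UU B₁) (UU B₂) := by
  rw [disjoint_left]
  intro x h1 h2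
  obtain ⟨a, ha, hxa⟩ := mem_UU.1 h1
  obtain ⟨b, hb, hxb⟩ := mem_UU.1 h2
  exact disjoint_left.1 (S.hd a ha b hb) hxa hxb

lemma Setup.UUV (S : Setup V H B₁ B₂ C) : UU B₁ ⊆ V := by
  intro x h1
  obtain ⟨a, ha, hxa⟩ := mem_UU.1 h1
  exact (S.h3 a (S.m1 a ha)).1 hxa

lemma Setup.uu (S : Setup V H B₁ B₂ C) : (UU B₁).card + (UU B₂).card ≤ V.card := by
  rw [← card_union_of_disjoint S.dUU]
  exact card_le_card (union_subset S.UUV S.symm.UUV)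

lemma Setup.cUU (S : Setup V H B₁ B₂ C) : ∀ b ∈ B₁, b ⊆ UU B₁ ∧ b.card = 3 :=
  fun b hb => ⟨sub_UU hb, (S.h3 b (S.m1 b hb)).2⟩

lemma Setup.cen_le (S : Setup V H B₁ B₂ C) : (cen B₁).card ≤ 3 := by
  obtain ⟨b, hb⟩ := S.n1
  rw [← (S.cUU b hb).2]; exact card_le_card (cen_sub hb)

lemma Setup.free1 (S : Setup V H B₁ B₂ C) : P4Free B₁ := by
  rintro ⟨a, ha, b, hb, c, hc, d, hd, h⟩
  exact S.hfree ⟨a, S.m1 _ ha, b, S.m1 _ hb, c, S.m1 _ hc, d, S.m1 _ hd, h⟩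

/-- two points of c in UU B₂ when c avoids the centers of B₂. -/
lemma Setup.typeii (S : Setup V H B₁ B₂ C) {c : Finset ℕ} (hc : c ∈ C) (hd : Disjoint c (cen B₂)) :
    ∃ s ∈ cen B₁, ∃ g ∈ Cov B₂, c = insert s g := by
  have c3 := (S.h3 c (S.m3 c hc)).2
  obtain ⟨b, hb⟩ := S.n2
  obtain ⟨y, hyc, hyb⟩ := S.hc c hc b (by simp [hb])
  have : y ∉ cen B₂ := fun h => disjoint_left.1 hd hyc h
  rw [mem_cen S.n2] at this
  push Not at this
  obtain ⟨b', hb', hyb'⟩ := this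
  obtain ⟨z, hzc, hzb⟩ := S.hc c hc b' (by simp [hb'])
  have hyz : y ≠ z := by rintro rfl; exact hyb' hzb
  obtain ⟨a, ha⟩ := S.n1
  obtain ⟨x, hxc, hxa⟩ := S.hc c hc a (by simp [ha])
  have dU : ∀ w, w ∈ UU B₁ → w ∈ UU B₂ → False := fun w h h' => disjoint_left.1 S.dUU h h'
  have xU := mem_UU.2 ⟨a, ha, hxa⟩
  have yU := mem_UU.2 ⟨b, hb, hyb⟩
  have zU := mem_UU.2 ⟨b', hb', hzb⟩
  have hxy : x ≠ y := by rintro rfl; exact dU _ xU yU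
  have hxz : x ≠ z := by rintro rfl; exact dU _ xU zU
  have e := eq_triple c3 hxc hyc hzc hxy hxz hyz
  refine ⟨x, ?_, {y, z}, ?_, e⟩
  · rw [mem_cen S.n1]
    intro a' ha'
    obtain ⟨w, hwc, hwa⟩ := S.hc c hc a' (by simp [ha'])
    rw [e] at hwc
    simp only [mem_insert, mem_singleton] at hwc
    rcases hwc with rfl | rfl | rfl
    · exact hwa
    · exact (dU _ (mem_UU.2 ⟨a', ha', hwa⟩) yU).elim
    · exact (dU _ (mem_UU.2 ⟨a', ha', hwa⟩) zU).elim
  · rw [mem_Cov]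
    refine ⟨by grind, card_pair hyz, ?_, ?_⟩
    · rw [e] at hd; exact hd.mono_left (subset_insert _ _)
    · intro b'' hb''
      obtain ⟨w, hwc, hwa⟩ := S.hc c hc b'' (by simp [hb''])
      rw [e] at hwc
      simp only [mem_insert, mem_singleton] at hwc
      rcases hwc with rfl | h
      · exact (dU _ xU (mem_UU.2 ⟨b'', hb'', hwa⟩)).elim
      · exact ⟨w, by simpa using h, hwa⟩

lemma Setup.cii (S : Setup V H B₁ B₂ C) :
    (C.filter (fun c => Disjoint c (cen B₂))).card ≤ (cen B₁).card * (Cov B₂).card := by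
  rw [← card_product]
  refine (card_le_card (t := (cen B₁ ×ˢ Cov B₂).image (fun p => insert p.1 p.2)) ?_).trans card_image_le
  intro c hc
  rw [mem_filter] at hc
  obtain ⟨s, hs, g, hg, rfl⟩ := S.typeii hc.1 hc.2
  rw [mem_image]
  exact ⟨(s, g), by simp [hs, hg], rfl⟩

lemma Setup.Csum (S : Setup V H B₁ B₂ C) :
    C.card ≤ (C.filter (fun c => ¬ Disjoint c (cen B₁) ∧ ¬ Disjoint c (cen B₂))).card +
      (cen B₁).card * (Cov B₂).card + (cen B₂).card * (Cov B₁).card := by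
  have h1 := card_or C (fun c => ¬ Disjoint c (cen B₁) ∧ ¬ Disjoint c (cen B₂))
    (fun c => Disjoint c (cen B₂) ∨ Disjoint c (cen B₁)) (by intro t _; tauto)
  rw [filter_or] at h1
  have h2 := card_union_le (C.filter (fun c => Disjoint c (cen B₂))) (C.filter (fun c => Disjoint c (cen B₁)))
  have h3 := S.cii
  have h4 := S.symm.cii
  omega

lemma Setup.u3 (S : Setup V H B₁ B₂ C) : 3 ≤ (UU B₁).card := by
  obtain ⟨b, hb⟩ := S.n1
  rw [← (S.cUU b hb).2]; exact card_le_card (sub_UU hb)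

lemma Setup.u4 (S : Setup V H B₁ B₂ C) (h : (cen B₁).card < 3) : 4 ≤ (UU B₁).card := by
  by_contra! h4
  have := S.u3
  obtain ⟨b, hb⟩ := S.n1
  have hall : ∀ b' ∈ B₁, b' = UU B₁ := fun b' hb' => eq_of_subset_of_card_le (sub_UU hb')
    (by rw [(S.cUU b' hb').2]; omega)
  have : b ⊆ cen B₁ := by
    intro x hx
    rw [mem_cen S.n1]
    intro b' hb'
    rw [hall b' hb', ← hall b hb]; exact hx
  have := card_le_card this
  rw [(S.cUU b hb).2] at this
  omega

lemma Setup.cen3 (S : Setup V H B₁ B₂ C) (h : (cen B₁).card = 3) : B₁ = {cen B₁} := by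
  rw [eq_singleton_iff_nonempty_unique_mem]
  refine ⟨S.n1, fun b hb => (eq_of_subset_of_card_le (cen_sub hb) ?_).symm⟩
  rw [(S.cUU b hb).2, h]

lemma Setup.cen2 (S : Setup V H B₁ B₂ C) (h : (cen B₁).card = 2) : B₁.card ≤ (UU B₁).card - 2 := by
  obtain ⟨p, q, hpq, e⟩ := card_eq_two.1 h
  apply pair3 p q hpq
  intro t ht
  have := cen_sub ht
  rw [e] at this
  exact ⟨(S.cUU t ht).1, (S.cUU t ht).2, this (by simp), this (by simp)⟩

lemma Setup.cen1 (S : Setup V H B₁ B₂ C) (h : (cen B₁).card = 1) :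
    B₁.card ≤ ((UU B₁).card - 1).choose 2 := by
  obtain ⟨p, e⟩ := card_eq_one.1 h
  apply star3 p
  intro t ht
  have := cen_sub ht
  rw [e] at this
  exact ⟨(S.cUU t ht).1, (S.cUU t ht).2, this (by simp)⟩

lemma Setup.two_le (S : Setup V H B₁ B₂ C) (h : (cen B₁).card < 3) : 2 ≤ B₁.card := by
  by_contra! h2
  have : B₁.card = 1 := by have := card_pos.2 S.n1; omega
  obtain ⟨b, hb⟩ := card_eq_one.1 this
  have h3 := (S.cUU b (by simp [hb])).2
  have : b ⊆ cen B₁ := by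
    intro x hx
    rw [mem_cen S.n1, hb]; simpa using hx
  have := card_le_card this
  omega

lemma num0 {n m s b1 b g u : ℕ} (h : (g ≤ 9 ∧ b ≤ 8) ∨ (g ≤ 6 ∧ b ≤ m + 6) ∨
    (g ≤ 4 ∧ b ≤ 4 * (m - 2)) ∨
    (g ≤ 3 ∧ b ≤ (m - 1).choose 2 + 1) ∨
    (g ≤ 2 ∧ b ≤ (m - 1).choose 2 + (m - 3)) ∨
    (g ≤ 1 ∧ b ≤ (m - 2) * (m - 2) ∧ (9 ≤ m → b ≤ m.choose 2 + 2)))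
    (hm : 4 ≤ m) (h4 : m = 4 → g ≤ 6 ∧ b ≤ 4) (hu : u + m ≤ n) (hn : 7 ≤ n)
    (hs : (s = 3 ∧ b1 ≤ 1 ∧ 3 ≤ u) ∨ (s = 2 ∧ b1 ≤ u - 2 ∧ 4 ≤ u) ∨
      (s = 1 ∧ b1 ≤ (u - 1).choose 2 ∧ 4 ≤ u)) :
    Good n (b1 + b + s * g) := by
  have f1 : m.choose 2 = (m - 1).choose 2 + (m - 1) := by
    rw [← choose_two_facts]; congr 1; omega
  have f3 : (m = 4 ∧ m.choose 2 = 6 ∧ (m - 2) * (m - 2) = 4) ∨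
      (m = 5 ∧ m.choose 2 = 10 ∧ (m - 2) * (m - 2) = 9) ∨
      (m = 6 ∧ m.choose 2 = 15 ∧ (m - 2) * (m - 2) = 16) ∨
      (m = 7 ∧ m.choose 2 = 21 ∧ (m - 2) * (m - 2) = 25) ∨
      (m = 8 ∧ m.choose 2 = 28 ∧ (m - 2) * (m - 2) = 36) ∨ (9 ≤ m ∧ 7 * m ≤ m.choose 2 + 27) := by
    rcases le_or_gt m 8 with h | h
    · clear * - h hm
      interval_cases m <;> decide
    · right; right; right; right; right
      refine ⟨h, ?_⟩
      clear * - h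
      induction m, h using Nat.le_induction with
      | base => decide
      | succ k hk ih => rw [choose_two_facts]; omega
  have f3' : Nat.choose 3 2 = 3 := rfl
  have lb := choose_lb n
  have f10 : n ≤ 11 → (n - 4).choose 2 ≤ 21 := fun h => choose_mono2 (show n - 4 ≤ 7 by omega)
  have f11 : n = 7 → (n - 3).choose 2 ≤ 6 := fun h => choose_mono2 (show n - 3 ≤ 4 by omega)
  have f12 : n = 8 → (n - 3).choose 2 ≤ 10 := fun h => choose_mono2 (show n - 3 ≤ 5 by omega)
  generalize (m - 2) * (m - 2) = mm at *
  rcases hs with ⟨rfl, hb, hu'⟩ | ⟨rfl, hb, hu'⟩ | ⟨rfl, hb, hu'⟩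
  · have g1 : m.choose 2 ≤ (n - 3).choose 2 := choose_mono2 (by omega)
    unfold Good
    rcases f3 with ⟨k, f, f'⟩ | ⟨k, f, f'⟩ | ⟨k, f, f'⟩ | ⟨k, f, f'⟩ | ⟨k, f, f'⟩ | ⟨f, f'⟩ <;> omega
  · have g1 : m.choose 2 ≤ (n - 4).choose 2 := choose_mono2 (by omega)
    have g2 : (n - 3).choose 2 = (n - 4).choose 2 + (n - 4) := by
      rw [← choose_two_facts]; congr 1; omega
    unfold Good
    rcases f3 with ⟨k, f, f'⟩ | ⟨k, f, f'⟩ | ⟨k, f, f'⟩ | ⟨k, f, f'⟩ | ⟨k, f, f'⟩ | ⟨f, f'⟩ <;> omega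
  · have g2 : (n - 3).choose 2 = (n - 4).choose 2 + (n - 4) := by
      rw [← choose_two_facts]; congr 1; omega
    have g3 := conv (u - 1) m 3 (by omega) (by omega)
    have g4 := choose_mono2 (show u - 1 + m - 3 ≤ n - 4 by omega)
    have g5 : b + g ≤ m.choose 2 + 9 := by
      rcases f3 with ⟨k, f, f'⟩ | ⟨k, f, f'⟩ | ⟨k, f, f'⟩ | ⟨k, f, f'⟩ | ⟨k, f, f'⟩ | ⟨f, f'⟩ <;> omega
    clear h f1 f3 h4
    unfold Good
    omega

lemma case0 (S : Setup V H B₁ B₂ C) (h0 : cen B₂ = ∅) : Out V H := by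
  right; right
  obtain ⟨c, hc⟩ := S.hC
  obtain ⟨s, hs, g, hg, -⟩ := S.typeii hc (by simp [h0])
  have hs1 := card_pos.2 ⟨s, hs⟩
  have hs3 := S.cen_le
  have hCc : C.card ≤ (cen B₁).card * (Cov B₂).card := by
    have := S.cii
    rwa [filter_true_of_mem (by simp [h0])] at this
  have hno : ∀ a, ∃ b ∈ B₂, a ∉ b := by
    intro a
    by_contra! h
    have := (mem_cen S.n2).2 h
    simp [h0] at this
  have t2 := tau2 (U := UU B₂) (B := B₂) (G := Cov B₂) S.symm.cUU
    (fun g hg => ⟨(mem_Cov.1 hg).1, (mem_Cov.1 hg).2.1⟩)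
    (fun g hg b hb => (mem_Cov.1 hg).2.2.2 b hb) hno S.symm.free1 ⟨g, hg⟩
  have u4 := S.symm.u4 (by simp [h0])
  have h4 : (UU B₂).card = 4 → (Cov B₂).card ≤ 6 ∧ B₂.card ≤ 4 := by
    intro h
    constructor
    · have := card_le_card (filter_subset (fun g => Disjoint g (cen B₂) ∧ ∀ b ∈ B₂, ∃ x, x ∈ g ∧ x ∈ b)
        ((UU B₂).powersetCard 2))
      rw [card_powersetCard, h] at this
      exact this
    · have := card_le_card (show B₂ ⊆ (UU B₂).powersetCard 3 from fun b hb => mem_powersetCard.2 (S.symm.cUU b hb))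
      rw [card_powersetCard, h] at this
      exact this
  have := num0 (n := V.card) (s := (cen B₁).card) (b1 := B₁.card) t2 u4 h4 S.uu S.hn (by
    have h : (cen B₁).card = 3 ∨ (cen B₁).card = 2 ∨ (cen B₁).card = 1 := by omega
    rcases h with h | h | h
    · left
      have h5 := S.cen3 h
      refine ⟨h, ?_, S.u3⟩
      rw [h5]; simp
    · right; left; exact ⟨h, S.cen2 h, S.u4 (by omega)⟩
    · right; right; exact ⟨h, S.cen1 h, S.u4 (by omega)⟩)
  apply good_mono this
  have := S.card_le
  omega

/-- link of the unique center -/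
lemma Setup.link (S : Setup V H B₁ B₂ C) {v : ℕ} (hv : cen B₁ = {v}) :
    ∃ L : Finset (Finset ℕ), L.card = B₁.card ∧ (∀ l ∈ L, l ⊆ (UU B₁).erase v ∧ l.card = 2) ∧
      (∀ g ∈ Cov B₁, g ⊆ (UU B₁).erase v ∧ g.card = 2) ∧ Cross (Cov B₁) L ∧
      (∀ a, ∃ l ∈ L, a ∉ l) ∧ ((UU B₁).erase v).card = (UU B₁).card - 1 := by
  have hvall : ∀ b ∈ B₁, v ∈ b := (mem_cen S.n1).1 (by simp [hv])
  have hvU : v ∈ UU B₁ := by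
    have : v ∈ cen B₁ := by simp [hv]
    exact (mem_filter.1 this).1
  refine ⟨B₁.image (fun t => t.erase v), erase_link _ _ hvall, ?_, ?_, ?_, ?_, card_erase_of_mem hvU⟩
  · intro l hl
    simp only [mem_image] at hl
    obtain ⟨t, ht, rfl⟩ := hl
    refine ⟨erase_subset_erase _ (sub_UU ht), ?_⟩
    rw [card_erase_of_mem (hvall t ht), (S.cUU t ht).2]
  · intro g hg
    rw [mem_Cov, hv] at hg
    refine ⟨subset_erase.2 ⟨hg.1, by simpa using hg.2.2.1⟩, hg.2.1⟩
  · intro g hg l hl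
    simp only [mem_image] at hl
    obtain ⟨t, ht, rfl⟩ := hl
    rw [mem_Cov, hv] at hg
    obtain ⟨x, h1, h2⟩ := hg.2.2.2 t ht
    refine ⟨x, h1, mem_erase.2 ⟨?_, h2⟩⟩
    rintro rfl
    simp at hg; exact hg.2.2.1 h1
  · intro a
    by_contra! h
    have : a ∈ cen B₁ := by
      rw [mem_cen S.n1]
      intro b hb
      exact mem_of_mem_erase (h _ (mem_image_of_mem _ hb))
    rw [hv, mem_singleton] at this
    obtain ⟨b, hb⟩ := S.n1
    have := h _ (mem_image_of_mem _ hb)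
    grind

lemma case11 (S : Setup V H B₁ B₂ C) (h1 : (cen B₁).card = 1) (h2 : (cen B₂).card = 1) : Out V H := by
  right; right
  obtain ⟨x, hx⟩ := card_eq_one.1 h1
  obtain ⟨v, hv⟩ := card_eq_one.1 h2
  have cs := S.Csum
  have cov1 : (Cov B₁).card ≤ 4 := by
    obtain ⟨L, l1, l2, l3, l4, l5, -⟩ := S.link hx
    exact gTot (r := 2) (fun k hk => (l3 k hk).2) l4 (fun l hl => (l2 l hl).2) l5
  have cov2 : (Cov B₂).card ≤ 4 := by
    obtain ⟨L, l1, l2, l3, l4, l5, -⟩ := S.symm.link hv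
    exact gTot (r := 2) (fun k hk => (l3 k hk).2) l4 (fun l hl => (l2 l hl).2) l5
  have hxv : x ≠ v := by
    have a1 : x ∈ cen B₁ := by simp [hx]
    have a2 : v ∈ cen B₂ := by simp [hv]
    rintro rfl
    exact disjoint_left.1 S.dUU (mem_filter.1 a1).1 (mem_filter.1 a2).1
  have ci : (C.filter (fun c => ¬ Disjoint c (cen B₁) ∧ ¬ Disjoint c (cen B₂))).card ≤ V.card - 2 := by
    apply pair3 x v hxv
    intro t ht
    rw [mem_filter, hx, hv] at ht
    have := S.h3 t (S.m3 t ht.1)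
    simp only [disjoint_singleton_right, not_not] at ht
    exact ⟨this.1, this.2, ht.2.1, ht.2.2⟩
  rw [h1, h2] at cs
  have b1 := S.cen1 h1
  have b2 := S.symm.cen1 h2
  have u1 := S.u4 (by omega)
  have u2 := S.symm.u4 (by omega)
  have uu := S.uu
  have cl := S.card_le
  have g3 := conv ((UU B₁).card - 1) ((UU B₂).card - 1) 3 (by omega) (by omega)
  have g4 := choose_mono2 (show (UU B₁).card - 1 + ((UU B₂).card - 1) - 3 ≤ V.card - 5 by omega)
  have hn := S.hn
  have e1 : (V.card - 3).choose 2 = (V.card - 4).choose 2 + (V.card - 4) := by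
    rw [← choose_two_facts]; congr 1; omega
  have e2 : (V.card - 4).choose 2 = (V.card - 5).choose 2 + (V.card - 5) := by
    rw [← choose_two_facts]; congr 1; omega
  have f3' : Nat.choose 3 2 = 3 := rfl
  have tot : H.card ≤ 3 + (V.card - 5).choose 2 + V.card + 6 := by omega
  unfold Good
  refine ⟨fun _ => by omega, ?_, ?_, ?_, ?_, ?_⟩ <;> intro hh <;> rw [hh] at tot <;>
    simp [Nat.choose] at tot <;> omega

end

section
variable {V : Finset ℕ} {H B₁ B₂ C : Finset (Finset ℕ)}

lemma Setup.cov_of2 (S : Setup V H B₁ B₂ C) (h : (cen B₁).card = 2) :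
    (Cov B₁).card ≤ 1 ∧ ((Cov B₁).Nonempty → B₁.card ≤ 2) := by
  obtain ⟨p, q, hpq, e⟩ := card_eq_two.1 h
  have hb : ∀ b ∈ B₁, ∃ z, z ≠ p ∧ z ≠ q ∧ b = {p, q, z} := by
    intro b hb
    have := cen_sub hb
    rw [e] at this
    exact three_of_pair (S.cUU b hb).2 (this (by simp)) (this (by simp)) hpq
  have hz : ∀ g ∈ Cov B₁, ∀ z, ({p, q, z} : Finset ℕ) ∈ B₁ → z ∈ g := by
    intro g hg z hz
    rw [mem_Cov, e] at hg
    obtain ⟨x, h1, h2⟩ := hg.2.2.2 _ hz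
    have h3 := disjoint_left.1 hg.2.2.1 h1
    grind
  constructor
  · obtain ⟨b, hb1, b', hb2, hne⟩ := one_lt_card.1 (S.two_le (by omega))
    obtain ⟨z, -, -, rfl⟩ := hb b hb1
    obtain ⟨z', -, -, rfl⟩ := hb b' hb2
    have hzz : z ≠ z' := by rintro rfl; exact hne rfl
    rw [card_le_one]
    intro g hg g' hg'
    rw [eq_pair (mem_Cov.1 hg).2.1 (hz g hg z hb1) (hz g hg z' hb2) hzz,
      eq_pair (mem_Cov.1 hg').2.1 (hz g' hg' z hb1) (hz g' hg' z' hb2) hzz]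
  · rintro ⟨g, hg⟩
    rw [← (mem_Cov.1 hg).2.1]
    refine (card_le_card (t := g.image (fun z => {p, q, z})) ?_).trans card_image_le
    intro b hbb
    obtain ⟨z, -, -, rfl⟩ := hb b hbb
    exact mem_image_of_mem _ (hz g hg z hbb)

lemma Setup.cov_of3 (S : Setup V H B₁ B₂ C) (h : (cen B₁).card = 3) : Cov B₁ = ∅ := by
  rw [eq_empty_iff_forall_notMem]
  intro g hg
  rw [mem_Cov] at hg
  obtain ⟨b, hb⟩ := S.n1
  have hbc : b = cen B₁ := by
    have h' := hb
    rw [S.cen3 h] at h'; exact mem_singleton.1 h'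
  obtain ⟨x, h1, h2⟩ := hg.2.2.2 b hb
  rw [hbc] at h2
  exact disjoint_left.1 hg.2.2.1 h1 h2

lemma vpq_count {F : Finset (Finset ℕ)} {v p q : ℕ} (hF : ∀ t ∈ F, t ⊆ V ∧ t.card = 3 ∧ v ∈ t)
    (hvp : v ≠ p) (hvq : v ≠ q) (hp : p ∈ V) :
    F.card ≤ (V.card - 2) + (V.card - 3) + (F.filter (fun t => p ∉ t ∧ q ∉ t)).card := by
  have h1 := card_or F (fun t => p ∈ t) (fun t => p ∉ t) (fun t _ => em _)
  have h2 := card_or (F.filter (fun t => p ∉ t)) (fun t => q ∈ t) (fun t => q ∉ t) (fun t _ => em _)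
  simp only [filter_filter] at h2
  have h3 := pair3 (W := V) (F := F.filter (fun t => p ∈ t)) v p hvp (by
    intro t ht; rw [mem_filter] at ht; have := hF t ht.1; tauto)
  have h4 := pair3 (W := V.erase p) (F := F.filter (fun t => p ∉ t ∧ q ∈ t)) v q hvq (by
    intro t ht; rw [mem_filter] at ht; have := hF t ht.1
    exact ⟨subset_erase.2 ⟨this.1, ht.2.1⟩, this.2.1, this.2.2, ht.2.2⟩)
  rw [card_erase_of_mem hp] at h4
  omega

lemma Setup.centers_ne (S : Setup V H B₁ B₂ C) {x y : ℕ} (hx : x ∈ cen B₁) (hy : y ∈ cen B₂) : x ≠ y := by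
  rintro rfl
  exact disjoint_left.1 S.dUU (mem_filter.1 hx).1 (mem_filter.1 hy).1

lemma Setup.cenV (S : Setup V H B₁ B₂ C) {x : ℕ} (hx : x ∈ cen B₁) : x ∈ V :=
  S.UUV (mem_filter.1 hx).1

lemma case21 (S : Setup V H B₁ B₂ C) (h1 : (cen B₁).card = 2) (h2 : (cen B₂).card = 1) : Out V H := by
  obtain ⟨p, q, hpq, e⟩ := card_eq_two.1 h1
  obtain ⟨v, hv⟩ := card_eq_one.1 h2
  have hvp : v ≠ p := (S.centers_ne (x := p) (y := v) (by simp [e]) (by simp [hv])).symm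
  have hvq : v ≠ q := (S.centers_ne (x := q) (y := v) (by simp [e]) (by simp [hv])).symm
  have cs := S.Csum
  rw [h1, h2] at cs
  set F := C.filter (fun c => ¬ Disjoint c (cen B₁) ∧ ¬ Disjoint c (cen B₂)) with hFdef
  have hF : ∀ t ∈ F, t ⊆ V ∧ t.card = 3 ∧ v ∈ t := by
    intro t ht
    rw [hFdef, mem_filter, hv] at ht
    have := S.h3 t (S.m3 t ht.1)
    simp only [disjoint_singleton_right, not_not] at ht
    exact ⟨this.1, this.2, ht.2.2⟩
  have hF2 : ∀ t ∈ F, p ∈ t ∨ q ∈ t := by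
    intro t ht
    rw [hFdef, mem_filter, e] at ht
    have := ht.2.1
    rw [not_disjoint_iff] at this
    grind
  have ci := vpq_count hF hvp hvq (S.cenV (by simp [e]))
  have z : F.filter (fun t => p ∉ t ∧ q ∉ t) = ∅ := by
    rw [filter_eq_empty_iff]; intro t ht; have := hF2 t ht; tauto
  rw [z, card_empty] at ci
  have b1 := S.cen2 h1
  have b2 := S.symm.cen1 h2
  have b1' := S.two_le (by omega)
  have u1 := S.u4 (by omega)
  have u2 := S.symm.u4 (by omega)
  have uu := S.uu
  have cl := S.card_le
  have hn := S.hn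
  obtain ⟨cv1, cv2⟩ := S.cov_of2 h1
  obtain ⟨L, l1, l2, l3, l4, l5, l6⟩ := S.symm.link hv
  by_cases hc : (Cov B₂).Nonempty
  · right; right
    have hc1 := card_pos.2 hc
    have a1 := gA l3 l2 l4 hc
    have a2 := gB l3 l2 l4
    have a3 := gC (fun k hk => (l3 k hk).2) (fun l hl => (l2 l hl).2) l4
    have a4 := gTot (r := 2) (fun k hk => (l3 k hk).2) l4 (fun l hl => (l2 l hl).2) l5
    have a3' : 3 ≤ (Cov B₂).card → L.card ≤ 4 := fun h => a3 h l5
    clear a3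
    rw [l6] at a1 a2
    rw [l1] at a1 a2 a3'
    have lb := choose_lb V.card
    have key : B₂.card + 2 * (Cov B₂).card ≤ max 12 (2 * ((UU B₂).card - 1) - 1) := by omega
    unfold Good
    omega
  rw [not_nonempty_iff_eq_empty] at hc
  rw [hc, card_empty] at cs
  by_cases hb3 : 3 ≤ B₁.card
  · right; right
    have cv0 : (Cov B₁).card = 0 := by
      by_contra h
      have := cv2 (card_pos.1 (by omega))
      omega
    have g1 := choose_mono2 (show (UU B₂).card - 1 ≤ V.card - 3 - B₁.card by omega)
    obtain ⟨j, hj⟩ := Nat.exists_eq_add_of_le hb3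
    have g2 := choose_add (V.card - 6 - j) j
    have g3 : 3 * j ≤ (V.card - 6 - j) * j := Nat.mul_le_mul_right _ (by omega)
    rw [show V.card - 6 - j + j = V.card - 6 by omega] at g2
    rw [show V.card - 3 - B₁.card = V.card - 6 - j by omega] at g1
    have e1 := choose_two_facts (V.card - 4)
    have e2 := choose_two_facts (V.card - 5)
    have e3 := choose_two_facts (V.card - 6)
    rw [show V.card - 4 + 1 = V.card - 3 by omega] at e1
    rw [show V.card - 5 + 1 = V.card - 4 by omega] at e2
    rw [show V.card - 6 + 1 = V.card - 5 by omega] at e3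
    have tot : H.card ≤ 3 + (V.card - 6).choose 2 + 2 * V.card - 5 := by omega
    have f10 : V.card ≤ 11 → (V.card - 6).choose 2 ≤ 10 := fun h => choose_mono2 (show V.card - 6 ≤ 5 by omega)
    unfold Good
    omega
  · right; left
    obtain ⟨b, b', hbb, hB⟩ := card_eq_two.1 (show B₁.card = 2 by omega)
    have hb : ∀ b ∈ B₁, ∃ z, z ≠ p ∧ z ≠ q ∧ b = {p, q, z} := by
      intro b hb
      have := cen_sub hb
      rw [e] at this
      exact three_of_pair (S.cUU b hb).2 (this (by simp)) (this (by simp)) hpq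
    obtain ⟨z1, z1p, z1q, rfl⟩ := hb b (by simp [hB])
    obtain ⟨z2, z2p, z2q, rfl⟩ := hb b' (by simp [hB])
    have hzz : z1 ≠ z2 := by rintro rfl; exact hbb rfl
    have hUz1 : z1 ∈ UU B₁ := mem_UU.2 ⟨_, by rw [hB]; exact mem_insert_self _ _, by simp⟩
    have hUz2 : z2 ∈ UU B₁ := mem_UU.2 ⟨{p, q, z2}, by rw [hB]; simp, by simp⟩
    have hvc : v ∈ cen B₂ := by simp [hv]
    have hUv : v ∉ UU B₁ := fun h => disjoint_left.1 S.dUU h (mem_filter.1 hvc).1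
    have vz1 : v ≠ z1 := by rintro rfl; exact hUv hUz1
    have vz2 : v ≠ z2 := by rintro rfl; exact hUv hUz2
    have pV : p ∈ V := S.cenV (by simp [e])
    have qV : q ∈ V := S.cenV (by simp [e])
    have vV : v ∈ V := S.symm.cenV hvc
    refine ⟨_, ⟨v, p, q, z1, z2, ?_, ?_, rfl⟩, ?_⟩
    · have := S.UUV hUz1
      have := S.UUV hUz2
      grind
    · rw [card_insert_of_notMem (by grind), card_insert_of_notMem (by grind),
        card_insert_of_notMem (by grind), card_pair hzz]
    · have star : ∀ t ∈ H, v ∈ t → z1 ∉ t → z2 ∉ t →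
          t ∈ ((V \ {z1, z2}).powersetCard 3).filter (fun t => v ∈ t) := by
        intro t ht hvt h1 h2
        rw [mem_filter, mem_powersetCard, subset_sdiff]
        refine ⟨⟨⟨(S.h3 t ht).1, ?_⟩, (S.h3 t ht).2⟩, hvt⟩
        rw [disjoint_right]; intro x hx; simp only [mem_insert, mem_singleton] at hx
        rcases hx with rfl | rfl <;> assumption
      intro t ht
      rw [mem_union]
      have ht' := ht
      rw [S.hH, mem_union, mem_union] at ht'
      rcases ht' with (h | h) | h
      · right
        rw [hB] at h
        simp only [mem_insert, mem_singleton] at h ⊢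
        tauto
      · left
        refine star t ht (cen_sub h hvc) ?_ ?_
        · intro hz; exact disjoint_left.1 S.dUU hUz1 (sub_UU h hz)
        · intro hz; exact disjoint_left.1 S.dUU hUz2 (sub_UU h hz)
      · have hvt : v ∈ t := by
          by_contra hvt
          obtain ⟨s, hs, g, hg, -⟩ := S.typeii h (by simp [hv, hvt])
          simp [hc] at hg
        by_cases hz1 : z1 ∈ t
        · right
          have : p ∈ t ∨ q ∈ t ∨ z2 ∈ t := by
            obtain ⟨x, x1, x2⟩ := S.hc t h {p, q, z2} (by rw [hB]; simp)
            grind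
          have t3 := (S.h3 t ht).2
          simp only [mem_insert, mem_singleton]
          rcases this with h' | h' | h'
          · have := eq_triple t3 hvt h' hz1 hvp vz1 z1p.symm
            simp [this]
          · have := eq_triple t3 hvt h' hz1 hvq vz1 z1q.symm
            simp [this]
          · have := eq_triple t3 hvt hz1 h' vz1 vz2 hzz
            simp [this]
        by_cases hz2 : z2 ∈ t
        · right
          have : p ∈ t ∨ q ∈ t := by
            obtain ⟨x, x1, x2⟩ := S.hc t h {p, q, z1} (by rw [hB]; simp)
            grind
          have t3 := (S.h3 t ht).2
          simp only [mem_insert, mem_singleton]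
          rcases this with h' | h'
          · have := eq_triple t3 hvt h' hz2 hvp vz2 z2p.symm
            simp [this]
          · have := eq_triple t3 hvt h' hz2 hvq vz2 z2q.symm
            simp [this]
        · left; exact star t ht hvt hz1 hz2

lemma num31 {n h : ℕ} (hn : 7 ≤ n) (hh : h ≤ max (5 * n - 18) 20) : Good n h := by
  have lb := choose_lb n
  unfold Good
  refine ⟨fun _ => ?_, fun _ => ?_, fun _ => ?_, fun _ => ?_, fun _ => ?_, fun _ => ?_⟩ <;> omega

lemma num31a {n h b1 b2 c F D g u1 u2 : ℕ} (hn : 7 ≤ n) (h1 : b1 = 1) (cl : h ≤ b1 + b2 + c)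
    (cs : c ≤ F + D) (dc : D ≤ 3 * g) (hu1 : 3 ≤ u1) (uu : u1 + u2 ≤ n)
    (ci : F ≤ (n - 2) + (n - 3) + (n - 4)) (hg : 2 ≤ g) (a2 : 2 ≤ g → b2 ≤ max (u2 - 1) 4)
    (a3 : 3 ≤ g → b2 ≤ 4) (a5 : 4 ≤ g → b2 ≤ 2) (a4 : g ≤ 2 * 2) : Good n h := by
  have lb := choose_lb n
  have : b2 + 3 * g ≤ max (n + 2) 14 := by
    have := a2 hg
    omega
  have : h ≤ 3 * n - 8 + max (n + 2) 14 := by omega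
  clear a2 a3 a5
  unfold Good
  refine ⟨fun _ => ?_, fun _ => ?_, fun _ => ?_, fun _ => ?_, fun _ => ?_, fun _ => ?_⟩ <;> omega

lemma num31b {n h b1 b2 c F D u1 u2 : ℕ} (hn : 7 ≤ n) (h1 : b1 = 1) (cl : h ≤ b1 + b2 + c)
    (cs : c ≤ F + D) (hu1 : 3 ≤ u1) (hu2 : 4 ≤ u2) (uu : u1 + u2 ≤ n)
    (ci : F + D ≤ max (3 * n - 8) 14) (a1 : b2 ≤ 2 * (u2 - 1) - 3) : Good n h :=
  num31 hn (by omega)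

lemma case31 (S : Setup V H B₁ B₂ C) (h1 : (cen B₁).card = 3) (h2 : (cen B₂).card = 1) : Out V H := by
  obtain ⟨v, hv⟩ := card_eq_one.1 h2
  have hvc : v ∈ cen B₂ := by simp [hv]
  have hB1 := S.cen3 h1
  have hn := S.hn
  by_cases hc : Cov B₂ = ∅
  · left
    refine star_out S.h3 hn v (S.symm.cenV hvc) (cen B₁) ?_
    intro t ht
    rw [S.hH, mem_union, mem_union] at ht
    rcases ht with (h | h) | h
    · right; rw [hB1] at h; exact mem_singleton.1 h
    · left; exact cen_sub h hvc
    · left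
      by_contra hvt
      obtain ⟨s, hs, g, hg, -⟩ := S.typeii h (by simp [hv, hvt])
      simp [hc] at hg
  right; right
  have hcne := nonempty_iff_ne_empty.2 hc
  have cs := card_or C (fun c => ¬ Disjoint c (cen B₁) ∧ ¬ Disjoint c (cen B₂))
    (fun c => Disjoint c (cen B₂)) (by
      intro t ht
      by_cases h : Disjoint t (cen B₂)
      · exact Or.inr h
      · refine Or.inl ⟨?_, h⟩
        intro h'
        obtain ⟨s, hs, g, hg, -⟩ := S.symm.typeii ht h'
        simp [S.cov_of3 h1] at hg)
  set F := C.filter (fun c => ¬ Disjoint c (cen B₁) ∧ ¬ Disjoint c (cen B₂)) with hFdef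
  set D := C.filter (fun c => Disjoint c (cen B₂)) with hDdef
  have hF : ∀ t ∈ F, t ⊆ V ∧ t.card = 3 ∧ v ∈ t := by
    intro t ht
    rw [hFdef, mem_filter, hv] at ht
    have := S.h3 t (S.m3 t ht.1)
    simp only [disjoint_singleton_right, not_not] at ht
    exact ⟨this.1, this.2, ht.2.2⟩
  have cnt : ∀ p q r, p ≠ q → p ≠ r → q ≠ r → cen B₁ = {p, q, r} →
      F.card ≤ (V.card - 2) + (V.card - 3) + (F.filter (fun t => p ∉ t ∧ q ∉ t)).card ∧
      ∀ t ∈ F.filter (fun t => p ∉ t ∧ q ∉ t), r ∈ t := by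
    intro p q r hpq hpr hqr e
    refine ⟨vpq_count hF (S.centers_ne (x := p) (y := v) (by simp [e]) hvc).symm
      (S.centers_ne (x := q) (y := v) (by simp [e]) hvc).symm (S.cenV (by simp [e])), ?_⟩
    intro t ht
    rw [mem_filter, hFdef, mem_filter, e] at ht
    have := ht.1.2.1
    rw [not_disjoint_iff] at this
    obtain ⟨w, w1, w2⟩ := this
    simp only [mem_insert, mem_singleton] at w2
    rcases w2 with rfl | rfl | rfl
    · exact absurd w1 ht.2.1
    · exact absurd w1 ht.2.2
    · exact w1
  have ci : F.card ≤ (V.card - 2) + (V.card - 3) + (V.card - 4) := by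
    obtain ⟨p, q, r, hpq, hpr, hqr, e⟩ := card_eq_three.1 h1
    obtain ⟨c1, c2⟩ := cnt p q r hpq hpr hqr e
    have := pair3 (W := V \ {p, q}) (F := F.filter (fun t => p ∉ t ∧ q ∉ t)) v r
      (S.centers_ne (x := r) (y := v) (by simp [e]) hvc).symm (by
        intro t ht
        have hr := c2 t ht
        rw [mem_filter] at ht
        obtain ⟨f1, f2, f3⟩ := hF t ht.1
        refine ⟨?_, f2, f3, hr⟩
        intro x hx
        have := f1 hx
        grind)
    rw [card_sdiff_of_subset (by
      have := S.cenV (x := p) (by simp [e])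
      have := S.cenV (x := q) (by simp [e])
      grind), card_pair hpq] at this
    omega
  have b2 := S.symm.cen1 h2
  have b1 : B₁.card = 1 := by rw [hB1]; simp
  have u1 := S.u3
  have u2 := S.symm.u4 (by omega)
  have uu := S.uu
  have cl := S.card_le
  have dc := S.cii
  rw [← hDdef, h1] at dc
  obtain ⟨L, l1, l2, l3, l4, l5, l6⟩ := S.symm.link hv
  have hc1 := card_pos.2 hcne
  have a1 := gA l3 l2 l4 hcne
  have a2 := gB l3 l2 l4
  have a3' : 3 ≤ (Cov B₂).card → L.card ≤ 4 := fun h =>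
    gC (fun k hk => (l3 k hk).2) (fun l hl => (l2 l hl).2) l4 h l5
  have a5 : 4 ≤ (Cov B₂).card → L.card ≤ 2 := fun h =>
    gD (fun k hk => (l3 k hk).2) (fun l hl => (l2 l hl).2) l4 h l5
  have a4 := gTot (r := 2) (fun k hk => (l3 k hk).2) l4 (fun l hl => (l2 l hl).2) l5
  rw [l6] at a1 a2
  rw [l1] at a1 a2 a3' a5
  have lb := choose_lb V.card
  by_cases hcov : 2 ≤ (Cov B₂).card
  · exact num31a hn b1 cl cs dc u1 uu ci hcov a2 a3' a5 a4
  have hcov1 : (Cov B₂).card = 1 := by omega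
  by_cases hD : D.card ≤ 1
  · exact num31b hn b1 cl cs u1 u2 uu (by clear a1 a2 a3' a5 lb cl; omega) a1
  obtain ⟨d, hd, d', hd', hdd⟩ := one_lt_card.1 (show 1 < D.card by omega)
  obtain ⟨g, hg⟩ := card_eq_one.1 hcov1
  obtain ⟨hdC, hdc⟩ := mem_filter.1 hd
  obtain ⟨hdC', hdc'⟩ := mem_filter.1 hd'
  obtain ⟨p, hp, g1, hg1, rfl⟩ := S.typeii hdC hdc
  obtain ⟨q, hq, g2, hg2, rfl⟩ := S.typeii hdC' hdc'
  have hgC : g ∈ Cov B₂ := by simp [hg]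
  rw [hg, mem_singleton] at hg1 hg2
  subst hg2 hg1
  have hpq : p ≠ q := by rintro rfl; exact hdd rfl
  obtain ⟨r, hrp, hrq, e⟩ := three_of_pair h1 hp hq hpq
  have hr : r ∈ cen B₁ := by simp [e]
  have hvp := S.centers_ne hp hvc
  have hvq := S.centers_ne hq hvc
  have hvr := S.centers_ne hr hvc
  have hgm := mem_Cov.1 hgC
  have hgU : ∀ x ∈ cen B₁, x ∉ g1 := fun x hx hxg =>
    disjoint_left.1 S.dUU (mem_filter.1 hx).1 (hgm.1 hxg)
  have pg := hgU p hp
  have qg := hgU q hq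
  have rg := hgU r hr
  have vg : v ∉ g1 := fun h => disjoint_left.1 hgm.2.2.1 h hvc
  obtain ⟨y, hy⟩ := card_pos.1 (show 0 < g1.card by omega)
  have path : ∀ a b, ({v, q, a} : Finset ℕ) ∈ H → ({v, r, b} : Finset ℕ) ∈ H →
      a ∉ insert p g1 → b ∉ insert p (insert q g1) → False := by
    intro a b ha hb ha' hb'
    refine nopath S.hfree y q v (S.m3 _ hdC) (S.m3 _ hdC') ha hb (by simp [hy]) (by simp) (by simp)
      ?_ ?_ ?_ <;>
    · rw [disjoint_left]
      intro x hx1 hx2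
      grind
  have fin : ∀ q' r', q' ≠ p → r' ≠ p → q' ≠ r' → cen B₁ = {p, q', r'} →
      (∀ a, ({v, r', a} : Finset ℕ) ∈ H → a ∈ insert p (insert q' g1)) →
      F.card ≤ (V.card - 2) + (V.card - 3) + 2 := by
    intro q' r' n1 n2 n3 e' hall
    obtain ⟨c1, c2⟩ := cnt p q' r' n1.symm n2.symm n3 e'
    have : (F.filter (fun t => p ∉ t ∧ q' ∉ t)).card ≤ g1.card := by
      refine (card_le_card (t := g1.image (fun z => {v, r', z})) ?_).trans card_image_le
      intro t ht
      have hr := c2 t ht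
      rw [mem_filter] at ht
      obtain ⟨f1, f2, f3⟩ := hF t ht.1
      obtain ⟨z, z1, z2, rfl⟩ := three_of_pair f2 f3 hr
        (S.centers_ne (x := r') (y := v) (by simp [e']) hvc).symm
      have hz := hall z (S.m3 _ (mem_filter.1 ht.1).1)
      rw [mem_image]
      refine ⟨z, ?_, rfl⟩
      grind
    rw [hgm.2.1] at this
    omega
  have ci' : F.card ≤ (V.card - 2) + (V.card - 3) + 2 := by
    by_cases hall : ∀ a, ({v, r, a} : Finset ℕ) ∈ H → a ∈ insert p (insert q g1)
    · exact fin q r hpq.symm hrp hrq.symm e hall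
    · push Not at hall
      obtain ⟨b, hb, hb'⟩ := hall
      refine fin r q hrp hpq.symm hrq (by rw [e, Finset.pair_comm q r]) ?_
      intro a ha
      by_contra hcon
      exact path a b ha hb (fun h => hcon (by simp only [mem_insert] at h ⊢; exact h.imp_right Or.inr)) hb'
  rw [hcov1] at dc
  exact num31b hn b1 cl cs u1 u2 uu (by clear a1 a2 a3' a5 lb cl; omega) a1

end

def XX (V K : Finset ℕ) (H : Finset (Finset ℕ)) (p x : ℕ) : Finset ℕ :=
  (V \ K).filter (fun a => ({p, x, a} : Finset ℕ) ∈ H)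

lemma pairRule {X Y : Finset ℕ}
    (h : ∀ a b c, a ∈ X → a ∈ Y → b ∈ X → c ∈ Y → a ≠ b → a ≠ c → b ≠ c → False) :
    Disjoint X Y ∨ X.card ≤ 1 ∨ Y.card ≤ 1 ∨ (X = Y ∧ X.card = 2) := by
  by_cases hd : Disjoint X Y
  · exact Or.inl hd
  right
  by_cases hX : X.card ≤ 1
  · exact Or.inl hX
  right
  by_cases hY : Y.card ≤ 1
  · exact Or.inl hY
  right
  obtain ⟨a, aX, aY⟩ := not_disjoint_iff.1 hd
  obtain ⟨b, bX, hb⟩ := exists_mem_ne (show 1 < X.card by omega) a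
  obtain ⟨c, cY, hc⟩ := exists_mem_ne (show 1 < Y.card by omega) a
  have e1 : ∀ b' ∈ X, b' ≠ a → ∀ c' ∈ Y, c' ≠ a → b' = c' := by
    intro b' hb' h1 c' hc' h2
    by_contra h3
    exact h a b' c' aX aY hb' hc' h1.symm h2.symm h3
  have hX2 : X = {a, b} := by
    ext t
    simp only [mem_insert, mem_singleton]
    constructor
    · intro ht
      by_cases hta : t = a
      · exact Or.inl hta
      · right; rw [e1 t ht hta c cY hc, e1 b bX hb c cY hc]
    · rintro (rfl | rfl) <;> assumption
  have hY2 : Y = {a, b} := by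
    ext t
    simp only [mem_insert, mem_singleton]
    constructor
    · intro ht
      by_cases hta : t = a
      · exact Or.inl hta
      · right; exact (e1 b bX hb t ht hta).symm
    · rintro (rfl | rfl)
      · exact aY
      · rw [e1 _ bX hb c cY hc]; exact cY
  exact ⟨hX2.trans hY2.symm, by rw [hX2, card_pair hb.symm]⟩

lemma pair_sum {X Y P : Finset ℕ} (hX : X ⊆ P) (hY : Y ⊆ P)
    (h : Disjoint X Y ∨ X.card ≤ 1 ∨ Y.card ≤ 1 ∨ (X = Y ∧ X.card = 2)) :
    X.card + Y.card ≤ max (P.card + 1) 4 := by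
  have h1 := card_le_card hX
  have h2 := card_le_card hY
  rcases h with h | h | h | ⟨h, h'⟩
  · have := card_le_card (union_subset hX hY)
    rw [card_union_of_disjoint h] at this
    omega
  · omega
  · omega
  · rw [← h]; omega

lemma triple_sum {X Y Z P : Finset ℕ} (hX : X ⊆ P) (hY : Y ⊆ P) (hZ : Z ⊆ P)
    (h1 : Disjoint X Y ∨ X.card ≤ 1 ∨ Y.card ≤ 1 ∨ (X = Y ∧ X.card = 2))
    (h2 : Disjoint X Z ∨ X.card ≤ 1 ∨ Z.card ≤ 1 ∨ (X = Z ∧ X.card = 2))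
    (h3 : Disjoint Y Z ∨ Y.card ≤ 1 ∨ Z.card ≤ 1 ∨ (Y = Z ∧ Y.card = 2)) :
    X.card + Y.card + Z.card ≤ max (P.card + 2) 6 ∧ X.card + Y.card + Z.card ≤ 3 * P.card := by
  have c1 := card_le_card hX
  have c2 := card_le_card hY
  have c3 := card_le_card hZ
  have s1 := pair_sum hX hY h1
  have s2 := pair_sum hX hZ h2
  have s3 := pair_sum hY hZ h3
  refine ⟨?_, by omega⟩
  have d : ∀ {A B : Finset ℕ}, A ⊆ P → B ⊆ P → Disjoint A B → A.card + B.card ≤ P.card := by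
    intro A B hA hB hd
    rw [← card_union_of_disjoint hd]
    exact card_le_card (union_subset hA hB)
  by_cases x1 : X.card ≤ 1
  · omega
  by_cases y1 : Y.card ≤ 1
  · omega
  by_cases z1 : Z.card ≤ 1
  · omega
  rcases h1 with h1 | h | h | ⟨h1, h1'⟩
  · rcases h2 with h2 | h | h | ⟨h2, h2'⟩
    · rcases h3 with h3 | h | h | ⟨h3, h3'⟩
      · have := d (union_subset hX hY) hZ (disjoint_union_left.2 ⟨h2, h3⟩)
        rw [card_union_of_disjoint h1] at this
        omega
      · omega
      · omega
      · have := d hX hY h1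
        rw [← h3]; omega
    · omega
    · omega
    · have := d hX hY h1
      rw [← h2]; omega
  · omega
  · omega
  · rw [← h1]
    rcases h2 with h2 | h | h | ⟨h2, h2'⟩
    · have := d hX hZ h2
      omega
    · omega
    · omega
    · rw [← h2]; omega

section
variable {V : Finset ℕ} {H B₁ B₂ C : Finset (Finset ℕ)}

lemma XX_sub (V K : Finset ℕ) (H : Finset (Finset ℕ)) (p x : ℕ) : XX V K H p x ⊆ V \ K := filter_subset _ _

lemma XX_rule {K : Finset ℕ} (hfree : P4Free H) {p q x y : ℕ} (hp : p ∈ K) (hq : q ∈ K) (hx : x ∈ K)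
    (hy : y ∈ K) (hpq : p ≠ q) (hxy : x ≠ y) (hpy : p ≠ y) (hxq : x ≠ q) :
    Disjoint (XX V K H p x) (XX V K H q y) ∨ (XX V K H p x).card ≤ 1 ∨ (XX V K H q y).card ≤ 1 ∨
      (XX V K H p x = XX V K H q y ∧ (XX V K H p x).card = 2) := by
  apply pairRule
  intro a b c aX aY bX cY hab hac hbc
  simp only [XX, mem_filter, mem_sdiff] at aX aY bX cY
  obtain ⟨⟨-, aK⟩, aX⟩ := aX
  obtain ⟨-, aY⟩ := aY
  obtain ⟨⟨-, bK⟩, bX⟩ := bX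
  obtain ⟨⟨-, cK⟩, cY⟩ := cY
  have n : ∀ {u v : ℕ}, u ∈ K → v ∉ K → u ≠ v := fun h1 h2 h => h2 (h ▸ h1)
  have := n hp aK; have := n hp bK; have := n hp cK
  have := n hq aK; have := n hq bK; have := n hq cK
  have := n hx aK; have := n hx bK; have := n hx cK
  have := n hy aK; have := n hy bK; have := n hy cK
  clear hp hq hx hy aK bK cK n
  refine nopath hfree p a q bX aX aY cY (by simp) (by simp) (by simp) ?_ ?_ ?_ <;> clear aX bX aY cY <;>
  · simp only [disjoint_insert_left, disjoint_singleton_left, mem_insert, mem_singleton]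
    grind

lemma Setup.ci_split (S : Setup V H B₁ B₂ C) {K : Finset ℕ} (hK : K = cen B₁ ∪ cen B₂)
    {F : Finset (Finset ℕ)} 
    (hF : F = C.filter (fun c => ¬ Disjoint c (cen B₁) ∧ ¬ Disjoint c (cen B₂))) :
    F.card ≤ (F.filter (fun t => t ⊆ K)).card + ∑ p ∈ cen B₁, ∑ x ∈ cen B₂, (XX V K H p x).card := by
  have h1 := card_or F (fun t => t ⊆ K) (fun t => ¬ t ⊆ K) (fun t _ => em _)
  refine h1.trans (Nat.add_le_add_left ?_ _)
  have : F.filter (fun t => ¬ t ⊆ K) ⊆ (cen B₁).biUnion (fun p => (cen B₂).biUnion (fun x =>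
      (XX V K H p x).image (fun a => ({p, x, a} : Finset ℕ)))) := by
    intro t ht
    rw [mem_filter, hF, mem_filter] at ht
    obtain ⟨⟨tC, d1, d2⟩, htK⟩ := ht
    obtain ⟨p, pt, p1⟩ := not_disjoint_iff.1 d1
    obtain ⟨x, xt, x1⟩ := not_disjoint_iff.1 d2
    have t3 := S.h3 t (S.m3 t tC)
    obtain ⟨a, -, -, rfl⟩ := three_of_pair t3.2 pt xt (S.centers_ne p1 x1)
    simp only [mem_biUnion, mem_image]
    refine ⟨p, p1, x, x1, a, ?_, rfl⟩
    simp only [XX, mem_filter, mem_sdiff]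
    refine ⟨⟨t3.1 (by simp), ?_⟩, S.m3 _ tC⟩
    intro ha
    apply htK
    intro y hy
    simp only [mem_insert, mem_singleton] at hy
    rcases hy with rfl | rfl | rfl
    · rw [hK]; exact mem_union_left _ p1
    · rw [hK]; exact mem_union_right _ x1
    · exact ha
  refine (card_le_card this).trans (card_biUnion_le.trans (sum_le_sum fun p _ => 
    card_biUnion_le.trans (sum_le_sum fun x _ => card_image_le)))

lemma Setup.cenD (S : Setup V H B₁ B₂ C) : Disjoint (cen B₁) (cen B₂) := by
  rw [disjoint_left]; intro x h1 h2; exact S.centers_ne h1 h2 rfl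

lemma Setup.poolcard (S : Setup V H B₁ B₂ C) :
    (V \ (cen B₁ ∪ cen B₂)).card = V.card - ((cen B₁).card + (cen B₂).card) := by
  rw [card_sdiff_of_subset, card_union_of_disjoint S.cenD]
  exact union_subset (fun x h => S.cenV h) (fun x h => S.symm.cenV h)

lemma Setup.Fin_sub (S : Setup V H B₁ B₂ C) {K : Finset ℕ}
    {F : Finset (Finset ℕ)} 
    (hF : F = C.filter (fun c => ¬ Disjoint c (cen B₁) ∧ ¬ Disjoint c (cen B₂))) :
    F.filter (fun t => t ⊆ K) ⊆ ((K.powersetCard 3).erase (cen B₁)).erase (cen B₂) := by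
  intro t ht
  rw [mem_filter, hF, mem_filter] at ht
  obtain ⟨⟨tC, d1, d2⟩, htK⟩ := ht
  rw [mem_erase, mem_erase, mem_powersetCard]
  refine ⟨?_, ?_, htK, (S.h3 t (S.m3 t tC)).2⟩
  · rintro rfl; exact d1 S.cenD.symm
  · rintro rfl; exact d2 S.cenD

lemma case22 (S : Setup V H B₁ B₂ C) (h1 : (cen B₁).card = 2) (h2 : (cen B₂).card = 2) : Out V H := by
  right; right
  obtain ⟨p, q, hpq, e⟩ := card_eq_two.1 h1
  obtain ⟨x, y, hxy, e'⟩ := card_eq_two.1 h2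
  obtain ⟨K, hK⟩ : ∃ K, K = cen B₁ ∪ cen B₂ := ⟨_, rfl⟩
  obtain ⟨F, hF⟩ : ∃ F, F = C.filter (fun c => ¬ Disjoint c (cen B₁) ∧ ¬ Disjoint c (cen B₂)) := ⟨_, rfl⟩
  have cs := S.Csum
  rw [← hF, h1, h2] at cs
  have ci := S.ci_split hK hF
  have kc : K.card = 4 := by rw [hK, card_union_of_disjoint S.cenD, h1, h2]
  have fi := (card_le_card (S.Fin_sub (K := K) hF)).trans
    ((card_le_card (erase_subset _ _)).trans (card_le_card (erase_subset _ _)))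
  rw [card_powersetCard, kc] at fi
  rw [e, e', sum_pair hpq, sum_pair hxy, sum_pair hxy] at ci
  have pc := S.poolcard
  rw [← hK, h1, h2] at pc
  have pn : ∀ {a b}, a ∈ cen B₁ → b ∈ cen B₂ → a ≠ b := fun ha hb => S.centers_ne ha hb
  have ps : p ∈ cen B₁ := by simp [e]
  have qs : q ∈ cen B₁ := by simp [e]
  have xs : x ∈ cen B₂ := by simp [e']
  have ys : y ∈ cen B₂ := by simp [e']
  have kk : ∀ {a}, a ∈ cen B₁ → a ∈ K := fun h => by rw [hK]; exact mem_union_left _ h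
  have kk' : ∀ {a}, a ∈ cen B₂ → a ∈ K := fun h => by rw [hK]; exact mem_union_right _ h
  have r1 := pair_sum (XX_sub V K H p x) (XX_sub V K H q y) (XX_rule S.hfree (kk ps) (kk qs) (kk' xs) (kk' ys)
    hpq hxy (pn ps ys) (pn qs xs).symm)
  have r2 := pair_sum (XX_sub V K H p y) (XX_sub V K H q x) (XX_rule S.hfree (kk ps) (kk qs) (kk' ys) (kk' xs)
    hpq hxy.symm (pn ps xs) (pn qs ys).symm)
  rw [pc] at r1 r2
  have cv1 := (S.cov_of2 h1).1
  have cv2 := (S.symm.cov_of2 h2).1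
  have b1 := S.cen2 h1
  have b2 := S.symm.cen2 h2
  have u1 := S.u4 (by omega)
  have u2 := S.symm.u4 (by omega)
  have uu := S.uu
  have cl := S.card_le
  have hch : Nat.choose 4 3 = 4 := by decide
  have tot : H.card ≤ 3 * V.card - 2 := by omega
  have lb := choose_lb V.card
  clear cl cs ci r1 r2 fi
  unfold Good
  refine ⟨fun _ => ?_, fun _ => ?_, fun _ => ?_, fun _ => ?_, fun _ => ?_, fun _ => ?_⟩ <;> omega

lemma case32 (S : Setup V H B₁ B₂ C) (h1 : (cen B₁).card = 3) (h2 : (cen B₂).card = 2) : Out V H := by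
  right; right
  obtain ⟨p, q, r, hpq, hpr, hqr, e⟩ := card_eq_three.1 h1
  obtain ⟨x, y, hxy, e'⟩ := card_eq_two.1 h2
  obtain ⟨K, hK⟩ : ∃ K, K = cen B₁ ∪ cen B₂ := ⟨_, rfl⟩
  obtain ⟨F, hF⟩ : ∃ F, F = C.filter (fun c => ¬ Disjoint c (cen B₁) ∧ ¬ Disjoint c (cen B₂)) := ⟨_, rfl⟩
  have cs := S.Csum
  rw [← hF, h1, h2, S.cov_of3 h1, card_empty] at cs
  have ci := S.ci_split hK hF
  have kc : K.card = 5 := by rw [hK, card_union_of_disjoint S.cenD, h1, h2]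
  have fi := (card_le_card (S.Fin_sub (K := K) hF)).trans
    (card_le_card (erase_subset _ _))
  rw [card_erase_of_mem (by rw [mem_powersetCard, hK]; exact ⟨subset_union_left, h1⟩),
    card_powersetCard, kc] at fi
  rw [e, e', sum_insert (by simp [hpq, hpr]), sum_pair hqr, sum_pair hxy, sum_pair hxy, sum_pair hxy] at ci
  have pc := S.poolcard
  rw [← hK, h1, h2] at pc
  have pn : ∀ {a b}, a ∈ cen B₁ → b ∈ cen B₂ → a ≠ b := fun ha hb => S.centers_ne ha hb
  have ps : p ∈ cen B₁ := by simp [e]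
  have qs : q ∈ cen B₁ := by simp [e]
  have rs : r ∈ cen B₁ := by simp [e]
  have xs : x ∈ cen B₂ := by simp [e']
  have ys : y ∈ cen B₂ := by simp [e']
  have kk : ∀ {a}, a ∈ cen B₁ → a ∈ K := fun h => by rw [hK]; exact mem_union_left _ h
  have kk' : ∀ {a}, a ∈ cen B₂ → a ∈ K := fun h => by rw [hK]; exact mem_union_right _ h
  have rr : ∀ {a b}, a ∈ cen B₁ → b ∈ cen B₁ → a ≠ b → 
      (XX V K H a x).card + (XX V K H b y).card ≤ max (V.card - 5 + 1) 4 := by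
    intro a b ha hb hab
    have := pair_sum (XX_sub V K H a x) (XX_sub V K H b y) (XX_rule S.hfree (kk ha) (kk hb) (kk' xs) (kk' ys)
      hab hxy (pn ha ys) (pn hb xs).symm)
    rwa [pc] at this
  have r1 := rr ps qs hpq
  have r2 := rr qs rs hqr
  have r3 := rr rs ps hpr.symm
  obtain ⟨cv2, cv3⟩ := S.symm.cov_of2 h2
  have b1 : B₁.card = 1 := by rw [S.cen3 h1]; simp
  have b2 := S.symm.cen2 h2
  have u1 := S.u3
  have u2 := S.symm.u4 (by omega)
  have uu := S.uu
  have cl := S.card_le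
  have hch : Nat.choose 5 3 = 10 := by decide
  have bb : B₂.card + 3 * (Cov B₂).card ≤ max (V.card - 5) 5 := by
    by_cases hc : (Cov B₂).Nonempty
    · have := cv3 hc; omega
    · rw [not_nonempty_iff_eq_empty.1 hc]; simp only [card_empty]; omega
  have ft : F.card ≤ 9 + 3 * max (V.card - 5 + 1) 4 := by omega
  have tot : H.card ≤ 10 + 3 * max (V.card - 5 + 1) 4 + max (V.card - 5) 5 := by omega
  have lb := choose_lb V.card
  have hn := S.hn
  clear cl cs ci r1 r2 r3 fi bb ft b2 cv2
  unfold Good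
  refine ⟨fun _ => ?_, fun _ => ?_, fun _ => ?_, fun _ => ?_, fun _ => ?_, fun _ => ?_⟩ <;> omega

end

section
variable {V : Finset ℕ} {H B₁ B₂ C : Finset (Finset ℕ)}

/-- sixteen interior edges suffice when two diagonal sets have distinct points -/
lemma inner16 (S : Setup V H B₁ B₂ C) {F : Finset (Finset ℕ)} {K : Finset ℕ} (hK : K = cen B₁ ∪ cen B₂)
    (hF : F = C.filter (fun c => ¬ Disjoint c (cen B₁) ∧ ¬ Disjoint c (cen B₂)))
    {p q r x y z a b : ℕ} (e : cen B₁ = {p, q, r}) (e' : cen B₂ = {x, y, z})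
    (h1 : (cen B₁).card = 3) (h2 : (cen B₂).card = 3)
    (hpq : p ≠ q) (hpr : p ≠ r) (hqr : q ≠ r) (hxy : x ≠ y) (hxz : x ≠ z) (hyz : y ≠ z)
    (ha : a ∈ XX V K H p x) (hb : b ∈ XX V K H q y) (hab : a ≠ b) :
    (F.filter (fun t => t ⊆ K)).card ≤ 16 := by
  have pn : ∀ {a b}, a ∈ cen B₁ → b ∈ cen B₂ → a ≠ b := fun ha hb => S.centers_ne ha hb
  have kc : K.card = 6 := by rw [hK, card_union_of_disjoint S.cenD, h1, h2]
  have pm1 : cen B₁ ∈ K.powersetCard 3 := by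
    rw [mem_powersetCard, hK]; exact ⟨subset_union_left, h1⟩
  have pm2 : cen B₂ ∈ K.powersetCard 3 := by
    rw [mem_powersetCard, hK]; exact ⟨subset_union_right, h2⟩
  have hne : cen B₂ ≠ cen B₁ := by
    intro h; have := S.cenD; rw [h, disjoint_self] at this
    rw [this] at h1; simp at h1
  have ps : p ∈ cen B₁ := by simp [e]
  have qs : q ∈ cen B₁ := by simp [e]
  have rs : r ∈ cen B₁ := by simp [e]
  have xs : x ∈ cen B₂ := by simp [e']
  have ys : y ∈ cen B₂ := by simp [e']
  have zs : z ∈ cen B₂ := by simp [e']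
  have px := pn ps xs; have py := pn ps ys; have pz := pn ps zs
  have qx := pn qs xs; have qy := pn qs ys; have qz := pn qs zs
  have rx := pn rs xs; have ry := pn rs ys; have rz := pn rs zs
  simp only [XX, mem_filter, mem_sdiff] at ha hb
  obtain ⟨⟨-, aK⟩, ha⟩ := ha
  obtain ⟨⟨-, bK⟩, hb⟩ := hb
  have hKK : K = {p, q, r, x, y, z} := by rw [hK, e, e']; simp only [insert_union, singleton_union]
  have aK' := aK
  have bK' := bK
  rw [hKK] at aK' bK'
  simp only [mem_insert, mem_singleton, not_or] at aK' bK'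
  obtain ⟨a1, a2, a3, a4, a5, a6⟩ := aK'
  obtain ⟨b1, b2, b3, b4, b5, b6⟩ := bK'
  have path : ∀ j, (j = r ∨ j = z) → ({p, x, j} : Finset ℕ) ∈ H → ({q, y, j} : Finset ℕ) ∈ H → False := by
    intro j hj m1 m2
    have jp : j ≠ p := by rcases hj with rfl | rfl; exacts [hpr.symm, pz.symm]
    have jq : j ≠ q := by rcases hj with rfl | rfl; exacts [hqr.symm, qz.symm]
    have jx : j ≠ x := by rcases hj with rfl | rfl; exacts [rx, hxz.symm]
    have jy : j ≠ y := by rcases hj with rfl | rfl; exacts [ry, hyz.symm]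
    have ja : j ≠ a := by rcases hj with rfl | rfl; exacts [Ne.symm a3, Ne.symm a6]
    have jb : j ≠ b := by rcases hj with rfl | rfl; exacts [Ne.symm b3, Ne.symm b6]
    clear hj
    refine nopath S.hfree p j q ha m1 m2 hb (by simp) (by simp) (by simp) ?_ ?_ ?_ <;>
      clear ha hb m1 m2 S hF hK e e' h1 h2 pm1 pm2 hne ps qs rs xs ys zs aK bK hKK kc pn <;>
    · simp only [disjoint_insert_left, disjoint_singleton_left, mem_insert, mem_singleton]
      grind
  have pick : ∀ j, (j = r ∨ j = z) → ∃ i ∈ ({p, x, j} : Finset ℕ) :: [({q, y, j} : Finset ℕ)], i ∉ H := by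
    intro j hj
    by_contra! hcon
    exact path j hj (hcon _ (by simp)) (hcon _ (by simp))
  obtain ⟨f, f1, f2⟩ := pick r (Or.inl rfl)
  obtain ⟨g, g1, g2⟩ := pick z (Or.inr rfl)
  simp only [List.mem_cons, List.not_mem_nil, or_false] at f1 g1
  have tri : ∀ {u v w : ℕ}, u ≠ v → u ≠ w → v ≠ w → u ∈ K → v ∈ K → w ∈ K → 
      ({u, v, w} : Finset ℕ) ∈ K.powersetCard 3 := by
    intro u v w h1 h2 h3 h4 h5 h6
    rw [mem_powersetCard]
    refine ⟨?_, card_eq_three.2 ⟨u, v, w, h1, h2, h3, rfl⟩⟩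
    intro t ht
    simp only [mem_insert, mem_singleton] at ht
    rcases ht with rfl | rfl | rfl <;> assumption
  have kp : p ∈ K := by simp [hKK]
  have kq : q ∈ K := by simp [hKK]
  have kr : r ∈ K := by simp [hKK]
  have kx : x ∈ K := by simp [hKK]
  have ky : y ∈ K := by simp [hKK]
  have kz : z ∈ K := by simp [hKK]
  have fK : f ∈ K.powersetCard 3 := by
    rcases f1 with rfl | rfl
    · exact tri px hpr rx.symm kp kx kr
    · exact tri qy hqr ry.symm kq ky kr
  have gK : g ∈ K.powersetCard 3 := by
    rcases g1 with rfl | rfl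
    · exact tri px pz hxz kp kx kz
    · exact tri qy qz hyz kq ky kz
  have rf : r ∈ f := by rcases f1 with rfl | rfl <;> simp
  have rg : r ∉ g := by
    rcases g1 with rfl | rfl
    · simp [hpr.symm, rx, rz]
    · simp [hqr.symm, ry, rz]
  have zg : z ∈ g := by rcases g1 with rfl | rfl <;> simp
  have zf : z ∉ f := by
    rcases f1 with rfl | rfl
    · simp [pz.symm, hxz.symm, rz.symm]
    · simp [qz.symm, hyz.symm, rz.symm]
  have zc1 : z ∉ cen B₁ := fun h => disjoint_left.1 S.cenD h zs
  have rc2 : r ∉ cen B₂ := fun h => disjoint_left.1 S.cenD rs h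
  have fc1 : f ≠ cen B₁ := by
    intro h
    rcases f1 with rfl | rfl
    · exact disjoint_left.1 S.cenD (h ▸ (by simp : x ∈ ({p, x, r} : Finset ℕ))) xs
    · exact disjoint_left.1 S.cenD (h ▸ (by simp : y ∈ ({q, y, r} : Finset ℕ))) ys
  have gc2 : g ≠ cen B₂ := by
    intro h
    rcases g1 with rfl | rfl
    · exact disjoint_left.1 S.cenD ps (h ▸ (by simp : p ∈ ({p, x, z} : Finset ℕ)))
    · exact disjoint_left.1 S.cenD qs (h ▸ (by simp : q ∈ ({q, y, z} : Finset ℕ)))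
  have fc2 : f ≠ cen B₂ := by rintro h; exact rc2 (h ▸ rf)
  have gc1 : g ≠ cen B₁ := by rintro h; exact zc1 (h ▸ zg)
  have fg : g ≠ f := by rintro rfl; exact rg rf
  have sub : F.filter (fun t => t ⊆ K) ⊆ 
      ((((K.powersetCard 3).erase (cen B₁)).erase (cen B₂)).erase f).erase g := by
    intro t ht
    have := S.Fin_sub hF ht
    rw [mem_filter, hF, mem_filter] at ht
    have tH := S.m3 t ht.1.1
    rw [mem_erase, mem_erase]
    refine ⟨?_, ?_, this⟩
    · rintro rfl; exact g2 tH
    · rintro rfl; exact f2 tH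
  have := card_le_card sub
  rw [card_erase_of_mem (by simp only [mem_erase]; exact ⟨fg, gc2, gc1, gK⟩),
    card_erase_of_mem (by simp only [mem_erase]; exact ⟨fc2, fc1, fK⟩),
    card_erase_of_mem (by simp only [mem_erase]; exact ⟨hne, pm2⟩),
    card_erase_of_mem pm1, card_powersetCard, kc] at this
  exact this

lemma two_distinct {X Y Z P : Finset ℕ} (hX : X ⊆ P) (hY : Y ⊆ P) (hZ : Z ⊆ P) (hP : P.card = 6)
    (h : 7 < X.card + Y.card + Z.card) :
    (∃ a ∈ X, ∃ b ∈ Y, a ≠ b) ∨ (∃ a ∈ X, ∃ b ∈ Z, a ≠ b) ∨ (∃ a ∈ Y, ∃ b ∈ Z, a ≠ b) := by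
  by_contra! hcon
  obtain ⟨h1, h2, h3⟩ := hcon
  have key : ∀ {A B : Finset ℕ}, (∀ a ∈ A, ∀ b ∈ B, a = b) → A.card = 0 ∨ B.card = 0 ∨ (A.card ≤ 1 ∧ B.card ≤ 1) := by
    intro A B hAB
    rcases A.eq_empty_or_nonempty with rfl | ⟨a, ha⟩
    · simp
    rcases B.eq_empty_or_nonempty with rfl | ⟨b, hb⟩
    · simp
    right; right
    constructor
    · rw [card_le_one]; intro u hu v hv; rw [hAB u hu b hb, hAB v hv b hb]
    · rw [card_le_one]; intro u hu v hv; rw [← hAB a ha u hu, ← hAB a ha v hv]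
  have := key h1
  have := key h2
  have := key h3
  have := card_le_card hX
  have := card_le_card hY
  have := card_le_card hZ
  omega

lemma case33 (S : Setup V H B₁ B₂ C) (h1 : (cen B₁).card = 3) (h2 : (cen B₂).card = 3) : Out V H := by
  right; right
  obtain ⟨p, q, r, hpq, hpr, hqr, e⟩ := card_eq_three.1 h1
  obtain ⟨x, y, z, hxy, hxz, hyz, e'⟩ := card_eq_three.1 h2
  obtain ⟨K, hK⟩ : ∃ K, K = cen B₁ ∪ cen B₂ := ⟨_, rfl⟩
  obtain ⟨F, hF⟩ : ∃ F, F = C.filter (fun c => ¬ Disjoint c (cen B₁) ∧ ¬ Disjoint c (cen B₂)) := ⟨_, rfl⟩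
  have cs := S.Csum
  rw [← hF, h1, h2, S.cov_of3 h1, S.symm.cov_of3 h2, card_empty] at cs
  have ci := S.ci_split hK hF
  have kc : K.card = 6 := by rw [hK, card_union_of_disjoint S.cenD, h1, h2]
  have pm1 : cen B₁ ∈ K.powersetCard 3 := by
    rw [mem_powersetCard, hK]; exact ⟨subset_union_left, h1⟩
  have pm2 : cen B₂ ∈ K.powersetCard 3 := by
    rw [mem_powersetCard, hK]; exact ⟨subset_union_right, h2⟩
  have hne : cen B₂ ≠ cen B₁ := by
    intro h; have := S.cenD; rw [h, disjoint_self] at this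
    rw [this] at h1; simp at h1
  have fi := card_le_card (S.Fin_sub (K := K) hF)
  rw [card_erase_of_mem (by simp only [mem_erase]; exact ⟨hne, pm2⟩),
    card_erase_of_mem pm1, card_powersetCard, kc] at fi
  rw [e, e', sum_insert (by simp [hpq, hpr]), sum_pair hqr, sum_insert (by simp [hxy, hxz]), sum_pair hyz,
    sum_insert (by simp [hxy, hxz]), sum_pair hyz, sum_insert (by simp [hxy, hxz]), sum_pair hyz] at ci
  have pc := S.poolcard
  rw [← hK, h1, h2] at pc
  have kk : ∀ {a}, a ∈ cen B₁ → a ∈ K := fun h => by rw [hK]; exact mem_union_left _ h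
  have kk' : ∀ {a}, a ∈ cen B₂ → a ∈ K := fun h => by rw [hK]; exact mem_union_right _ h
  have ru : ∀ {a b c d}, a ∈ cen B₁ → b ∈ cen B₁ → a ≠ b → c ∈ cen B₂ → d ∈ cen B₂ → c ≠ d → _ :=
    fun {a b c d} ha hb hab hc hd hcd =>
    XX_rule (V := V) (K := K) S.hfree (kk ha) (kk hb) (kk' hc) (kk' hd)
      hab hcd (S.centers_ne ha hd) (S.centers_ne hb hc).symm
  have hn := S.hn
  have b1 : B₁.card = 1 := by rw [S.cen3 h1]; simp
  have b2 : B₂.card = 1 := by rw [S.symm.cen3 h2]; simp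
  have cl := S.card_le
  have ps : p ∈ cen B₁ := by simp [e]
  have qs : q ∈ cen B₁ := by simp [e]
  have rs : r ∈ cen B₁ := by simp [e]
  have diag : ∀ x' y' z', x' ≠ y' → x' ≠ z' → y' ≠ z' → cen B₂ = {x', y', z'} →
      ((XX V K H p x').card + (XX V K H q y').card + (XX V K H r z').card ≤ max (V.card - 6 + 2) 6 ∧
      (XX V K H p x').card + (XX V K H q y').card + (XX V K H r z').card ≤ 3 * (V.card - 6)) ∧
      (V.card = 12 → 7 < (XX V K H p x').card + (XX V K H q y').card + (XX V K H r z').card →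
        (F.filter (fun t => t ⊆ K)).card ≤ 16) := by
    intro x' y' z' n1 n2 n3 e''
    have xs : x' ∈ cen B₂ := by simp [e'']
    have ys : y' ∈ cen B₂ := by simp [e'']
    have zs : z' ∈ cen B₂ := by simp [e'']
    constructor
    · have := triple_sum (XX_sub V K H p x') (XX_sub V K H q y') (XX_sub V K H r z')
        (ru ps qs hpq xs ys n1) (ru ps rs hpr xs zs n2) (ru qs rs hqr ys zs n3)
      rwa [pc] at this
    · intro hv h7
      rcases two_distinct (XX_sub V K H p x') (XX_sub V K H q y') (XX_sub V K H r z') (by rw [pc, hv]) h7 with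
        ⟨a, ha, b, hb, hab⟩ | ⟨a, ha, b, hb, hab⟩ | ⟨a, ha, b, hb, hab⟩
      · exact inner16 S hK hF e e'' h1 h2 hpq hpr hqr n1 n2 n3 ha hb hab
      · exact inner16 S hK hF (by rw [e, pair_comm q r]) (by rw [e'', pair_comm y' z']) h1 h2 
          hpr hpq hqr.symm n2 n1 n3.symm ha hb hab
      · exact inner16 S hK hF (q := r) (r := p) (by rw [e, insert_comm, pair_comm p r])
          (y := z') (z := x') (by rw [e'', insert_comm, pair_comm x' z']) h1 h2 
          hqr hpq.symm hpr.symm n3 n1.symm n2.symm ha hb hab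
  obtain ⟨⟨d1, d1'⟩, d1''⟩ := diag x y z hxy hxz hyz e'
  obtain ⟨⟨d2, d2'⟩, d2''⟩ := diag y z x hyz hxy.symm hxz.symm (by rw [e', insert_comm, pair_comm x z])
  obtain ⟨⟨d3, d3'⟩, d3''⟩ := diag z x y hxz.symm hyz.symm hxy (by rw [e', pair_comm y z, insert_comm])
  have hch : Nat.choose 6 3 = 20 := by decide
  clear diag ru kk kk'
  have t1 : H.card ≤ 20 + 3 * max (V.card - 6 + 2) 6 := by clear d1' d2' d3' d1'' d2'' d3''; omega
  have t2 : H.card ≤ 20 + 9 * (V.card - 6) := by clear d1 d2 d3 d1'' d2'' d3''; omega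
  have t3 : V.card = 12 → H.card ≤ 42 := by
    intro hv
    rw [hv] at d1 d2 d3
    replace d1'' := d1'' hv
    replace d2'' := d2'' hv
    replace d3'' := d3'' hv
    clear d1' d2' d3' t1 t2
    have hm : max (12 - 6 + 2) 6 = 8 := by decide
    rw [hm] at d1 d2 d3
    by_cases i16 : (F.filter (fun t => t ⊆ K)).card ≤ 16
    · clear d1'' d2'' d3''; omega
    · have := not_lt.1 (mt d1'' i16)
      have := not_lt.1 (mt d2'' i16)
      have := not_lt.1 (mt d3'' i16)
      clear d1'' d2'' d3'' d1 d2 d3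
      omega
  have lb := choose_lb V.card
  have h9 : (9 : ℕ).choose 2 = 36 := by decide
  clear d1 d2 d3 d1' d2' d3' d1'' d2'' d3'' ci fi cs cl
  unfold Good
  refine ⟨fun _ => ?_, fun _ => ?_, fun _ => ?_, fun _ => ?_, fun _ => ?_, fun _ => ?_⟩
  · by_cases h12 : V.card = 12
    · rw [h12]; have := t3 h12; simp only [Nat.reduceSub]; omega
    · omega
  all_goals omega

end

lemma star_lower {W : Finset ℕ} {x : ℕ} (hx : x ∈ W) :
    (W.card - 1).choose 2 ≤ ((W.powersetCard 3).filter (fun t => x ∈ t)).card := by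
  rw [← card_erase_of_mem hx, ← card_powersetCard 2 (W.erase x)]
  refine card_le_card_of_injOn (fun s => insert x s) ?_ ?_
  · intro s hs
    have hs := mem_powersetCard.1 (mem_coe.1 hs)
    have hxs : x ∉ s := fun h => notMem_erase x W (hs.1 h)
    rw [mem_coe, mem_filter, mem_powersetCard]
    refine ⟨⟨?_, by rw [card_insert_of_notMem hxs, hs.2]⟩, mem_insert_self _ _⟩
    exact insert_subset hx (hs.1.trans (erase_subset _ _))
  · intro s hs t ht h
    have hs := mem_powersetCard.1 (mem_coe.1 hs)
    have ht := mem_powersetCard.1 (mem_coe.1 ht)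
    have hxs : x ∉ s := fun h => notMem_erase x W (hs.1 h)
    have hxt : x ∉ t := fun h => notMem_erase x W (ht.1 h)
    rw [← erase_insert hxs, ← erase_insert hxt]
    exact congrArg (fun u => erase u x) h

lemma five_distinct {x y1 y2 z1 z2 : ℕ} (h : ({x, y1, y2, z1, z2} : Finset ℕ).card = 5) :
    (x ≠ y1 ∧ x ≠ y2 ∧ x ≠ z1 ∧ x ≠ z2) ∧ (y1 ≠ y2 ∧ y1 ≠ z1 ∧ y1 ≠ z2) ∧ (y2 ≠ z1 ∧ y2 ≠ z2) ∧ z1 ≠ z2 := by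
  have key : ∀ a b c d : ℕ, ({a, b, c, d} : Finset ℕ).card ≤ 4 := fun a b c d => card_le_four
  refine ⟨⟨?_, ?_, ?_, ?_⟩, ⟨?_, ?_, ?_⟩, ⟨?_, ?_⟩, ?_⟩
  · rintro rfl; have := key x y2 z1 z2; simp_all
  · rintro rfl; have := key y1 x z1 z2; simp_all
  · rintro rfl; have := key y1 y2 x z2; simp_all
  · rintro rfl; have := key y1 y2 z1 x; simp_all
  · rintro rfl; have := key x y1 z1 z2; simp_all
  · rintro rfl; have := key x y2 y1 z2; simp_all
  · rintro rfl; have := key x y2 z1 y1; simp_all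
  · rintro rfl; have := key x y1 y2 z2; simp_all
  · rintro rfl; have := key x y1 z1 y2; simp_all
  · rintro rfl; have := key x y1 y2 z1; simp_all

lemma seven {x y1 y2 z1 z2 : ℕ} (a1 : x ≠ y1) (a2 : x ≠ y2) (a3 : x ≠ z1) (a4 : x ≠ z2)
    (b1 : y1 ≠ y2) (b2 : y1 ≠ z1) (b3 : y1 ≠ z2) (c1 : y2 ≠ z1) (c2 : y2 ≠ z2) (d : z1 ≠ z2) :
    ({{y1, y2, z1}, {y1, y2, z2}, {x, y1, z1}, {x, y1, z2},
        {x, y2, z1}, {x, y2, z2}, {x, z1, z2}} : Finset (Finset ℕ)).card = 7 := by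
  have a1' := a1.symm; have a2' := a2.symm; have a3' := a3.symm; have a4' := a4.symm
  have b1' := b1.symm; have b2' := b2.symm; have b3' := b3.symm; have c1' := c1.symm
  have c2' := c2.symm; have d' := d.symm
  repeat rw [card_insert_of_notMem]
  · simp
  all_goals
    simp only [mem_insert, mem_singleton, not_or]
    repeat' apply And.intro
  all_goals
    first
    | (refine ne_of_mem_of_not_mem' (a := x) ?_ ?_ <;> simp [*] <;> done)
    | (refine ne_of_mem_of_not_mem' (a := y1) ?_ ?_ <;> simp [*] <;> done)
    | (refine ne_of_mem_of_not_mem' (a := y2) ?_ ?_ <;> simp [*] <;> done)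
    | (refine ne_of_mem_of_not_mem' (a := z1) ?_ ?_ <;> simp [*] <;> done)
    | (refine ne_of_mem_of_not_mem' (a := z2) ?_ ?_ <;> simp [*] <;> done)

lemma CB_card {V : Finset ℕ} {H : Finset (Finset ℕ)} (h : IsCBOn V H) :
    (V.card - 3).choose 2 + 7 ≤ H.card := by
  obtain ⟨x, y1, y2, z1, z2, hV, h5, rfl⟩ := h
  obtain ⟨⟨a1, a2, a3, a4⟩, ⟨b1, b2, b3⟩, ⟨c1, c2⟩, d⟩ := five_distinct h5
  rw [card_union_of_disjoint, seven a1 a2 a3 a4 b1 b2 b3 c1 c2 d]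
  · have hx : x ∈ V \ {z1, z2} := by
      rw [mem_sdiff]
      exact ⟨hV (by simp), by simp [a3, a4]⟩
    have := star_lower hx
    rw [card_sdiff_of_subset (fun t ht => hV (by simp only [mem_insert, mem_singleton] at ht ⊢; tauto)),
      card_pair d] at this
    rw [show V.card - 2 - 1 = V.card - 3 by omega] at this
    omega
  · rw [disjoint_left]
    intro t ht ht'
    rw [mem_filter, mem_powersetCard, subset_sdiff] at ht
    have hd := disjoint_right.1 ht.1.1.2
    have m1 : z1 ∉ t := hd (by simp)
    have m2 : z2 ∉ t := hd (by simp)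
    simp only [mem_insert, mem_singleton] at ht'
    rcases ht' with rfl | rfl | rfl | rfl | rfl | rfl | rfl <;> simp at m1 m2

lemma main_out : ∀ (n : ℕ) (V : Finset ℕ) (H : Finset (Finset ℕ)), V.card = n → 7 ≤ V.card →
    ThreeGraphOn V H → P4Free H → Out V H := by
  intro n
  induction n using Nat.strong_induction_on with
  | _ n ih =>
    intro V H hV hn h3 hfree
    by_cases hi : ∀ e ∈ H, ∀ f ∈ H, ¬ Disjoint e f
    · exact inter_case h3 hn hi
    push Not at hi
    obtain ⟨B₁, B₂, C, hH, n1, n2, hd, hc⟩ := decomp hfree hi (by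
      intro e he; rw [← card_pos, (h3 e he).2]; omega)
    rcases C.eq_empty_or_nonempty with rfl | hC
    · rw [union_empty] at hH
      refine disc_case h3 hfree ?_ hH n1 n2 hd
      intro V' H' hlt h3' hf'
      exact out_T h3' (fun h7 => ih V'.card (by omega) V' H' rfl h7 h3' hf')
    have S : Setup V H B₁ B₂ C := ⟨h3, hfree, hn, hH, n1, n2, hd, hc, hC⟩
    have s1 := S.cen_le
    have s2 := S.symm.cen_le
    by_cases z2 : cen B₂ = ∅
    · exact case0 S z2
    by_cases z1 : cen B₁ = ∅
    · exact case0 S.symm z1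
    have p1 := card_pos.2 (nonempty_iff_ne_empty.2 z1)
    have p2 := card_pos.2 (nonempty_iff_ne_empty.2 z2)
    have c1 : (cen B₁).card = 1 ∨ (cen B₁).card = 2 ∨ (cen B₁).card = 3 := by omega
    have c2 : (cen B₂).card = 1 ∨ (cen B₂).card = 2 ∨ (cen B₂).card = 3 := by omega
    rcases c1 with c1 | c1 | c1 <;> rcases c2 with c2 | c2 | c2
    · exact case11 S c1 c2
    · exact case21 S.symm c2 c1
    · exact case31 S.symm c2 c1
    · exact case21 S c1 c2
    · exact case22 S c1 c2
    · exact case32 S.symm c2 c1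
    · exact case31 S c1 c2
    · exact case32 S c1 c2
    · exact case33 S c1 c2

/-- For `n ≥ 12`: every `𝒫₄`-free 3-graph `H` on `n` vertices that is not a
sub-3-graph of the starplus `Sₙ⁺¹` satisfies `|H| ≤ C(n-3,2) + 7`, with
equality iff `H` is isomorphic to the compact balloon `CBₙ`. -/
theorem second_order_turan_large (n : ℕ) (hn : 12 ≤ n)
    (V : Finset ℕ) (H : Finset (Finset ℕ)) (hV : V.card = n)
    (hH : ThreeGraphOn V H) (hfree : P4Free H) (hns : ¬SubStarPlus V H) :
    H.card ≤ (n - 3).choose 2 + 7 ∧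
      (H.card = (n - 3).choose 2 + 7 ↔ IsCBOn V H) := by
  subst hV
  rcases main_out _ V H rfl (by omega) hH hfree with h | ⟨H', hCB, hs⟩ | h
  · exact absurd h hns
  · have c1 := CB_card_le hCB
    have c2 := card_le_card hs
    refine ⟨c2.trans c1, ?_, fun h => le_antisymm (CB_card_le h) (CB_card h)⟩
    intro h
    rw [eq_of_subset_of_card_le hs (by omega)]
    exact hCB
  · have := h.1 hn
    refine ⟨by omega, fun h' => by omega, fun h' => ?_⟩
    have := CB_card h'
    omega
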